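/- arXiv:2504.04356 — 13 statements merged into one kernel-verified Lean document; each statement's English description precedes it below -/
import Mathlib

section
/- Let t > 0 be a real number and let μ_1 ≤ μ_2 ≤ ⋯ be a nondecreasing sequence of positive real numbers satisfying the Yang-type inequality with parameter t. Then for all integers k ≥ 1 and ℓ ≥ 1, F_{k+ℓ}/(k+ℓ)^{4/t} ≤ F_k/k^{4/t}; that is, the sequence k ↦ F_k/k^{4/t} is nonincreasing (the Cheng–Yang recursion formula). -/
/-- Superadditivity-type bound for `sinh`: scaling the argument by `p ≥ 1` beats scaling the value. -/
lemma mul_sinh_le_sinh_mul {p u : ℝ} (hp : 1 ≤ p) (hu : 0 ≤ u) :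
    p * Real.sinh u ≤ Real.sinh (p * u) := by
  have hderiv : ∀ v : ℝ, HasDerivAt (fun v => Real.sinh (p * v) - p * Real.sinh v)
      (Real.cosh (p * v) * (p * 1) - p * Real.cosh v) v := fun v =>
    (((hasDerivAt_id v).const_mul p).sinh).sub ((Real.hasDerivAt_sinh v).const_mul p)
  have hmono : MonotoneOn (fun v => Real.sinh (p * v) - p * Real.sinh v) (Set.Ici 0) := by
    refine monotoneOn_of_deriv_nonneg (convex_Ici 0)
      (fun v _ => (hderiv v).continuousAt.continuousWithinAt)
      (fun v _ => (hderiv v).differentiableAt.differentiableWithinAt) fun v hv => ?_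
    rw [interior_Ici, Set.mem_Ioi] at hv
    rw [(hderiv v).deriv]
    have hcosh : Real.cosh v ≤ Real.cosh (p * v) := by
      rw [Real.cosh_le_cosh, abs_of_pos hv, abs_of_pos (by positivity)]
      nlinarith
    nlinarith
  have h := hmono Set.self_mem_Ici (Set.mem_Ici.2 hu) hu
  simpa using h

/-- For `R ≥ 1` and `a ≥ 0`, `R ^ (1 + a) - 1` dominates `(1 + a) * (R - 1) * R ^ (a / 2)`. -/
lemma mul_sub_one_mul_rpow_half_le {R a : ℝ} (hR : 1 ≤ R) (ha : 0 ≤ a) :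
    (1 + a) * (R - 1) * R ^ (a / 2) ≤ R * R ^ a - 1 := by
  have hR0 : 0 < R := by linarith
  obtain ⟨u, hu⟩ : ∃ u, u = Real.log R / 2 := ⟨_, rfl⟩
  have hu0 : 0 ≤ u := by rw [hu]; exact div_nonneg (Real.log_nonneg hR) zero_le_two
  have hlog : Real.log R = 2 * u := by rw [hu]; ring
  have hRu : R = Real.exp u * Real.exp u := by
    rw [← Real.exp_add, ← two_mul, ← hlog, Real.exp_log hR0]
  have hhalf : R ^ (a / 2) = Real.exp (a * u) := by
    rw [Real.rpow_def_of_pos hR0, hlog]; ring_nf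
  have hfull : R ^ a = Real.exp (a * u) * Real.exp (a * u) := by
    rw [← Real.exp_add, Real.rpow_def_of_pos hR0, hlog]; ring_nf
  have h := mul_sinh_le_sinh_mul (p := 1 + a) (by linarith) hu0
  have hexp : Real.exp ((1 + a) * u) = Real.exp u * Real.exp (a * u) := by
    rw [← Real.exp_add]; ring_nf
  rw [Real.sinh_eq, Real.sinh_eq, Real.exp_neg, Real.exp_neg, hexp] at h
  rw [hhalf, hfull, hRu]
  have hx := Real.exp_pos u
  have hy := Real.exp_pos (a * u)
  generalize Real.exp u = x at *
  generalize Real.exp (a * u) = y at *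
  have h' := mul_le_mul_of_nonneg_left h (by positivity : 0 ≤ 2 * (x * y))
  have e₁ : 2 * (x * y) * ((1 + a) * ((x - x⁻¹) / 2)) = (1 + a) * (x * x - 1) * y := by
    field_simp
  have e₂ : 2 * (x * y) * ((x * y - (x * y)⁻¹) / 2) = x * x * (y * y) - 1 := by
    field_simp
  linarith

/-- One step of the recursion, as an algebraic inequality between the means `G`, `T` of the first
`n` terms and the next term `x`. -/
lemma yang_step {a n c G T x : ℝ} (ha : 0 < a) (hn : 0 < n) (hc : 1 < c)
    (hcn : (1 + a) ^ 2 * c ≤ ((n + 1) * c - n) ^ 2)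
    (hyang : x ^ 2 - (2 + a) * G * x + (1 + a) * T ≤ 0) :
    (1 + a / 2) * ((n * G + x) / (n + 1)) ^ 2 - (n * T + x ^ 2) / (n + 1) ≤
      c * ((1 + a / 2) * G ^ 2 - T) := by
  obtain ⟨y, rfl⟩ : ∃ y, x = G + y := ⟨x - G, by ring⟩
  obtain ⟨A, hA⟩ : ∃ A, A = (n + 1) ^ 2 * c - (1 + a) * (a / 2) - n * (n + 1) + (1 + a) * n :=
    ⟨_, rfl⟩
  obtain ⟨B, hB⟩ : ∃ B, B = -a * ((n + 1) ^ 2 * c + (1 + a) * (n + 1) - n * (n + 1)) := ⟨_, rfl⟩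
  obtain ⟨C, hC⟩ : ∃ C, C = a / 2 * (1 + a) * (n + 1) ^ 2 * (c - 1) := ⟨_, rfl⟩
  have hCpos : 0 < C := by
    have : 0 < c - 1 := by linarith
    rw [hC]; positivity
  have hdisc : 0 ≤ 4 * A * C - B ^ 2 := by
    have : 4 * A * C - B ^ 2 =
        a * (2 + a) * (n + 1) ^ 2 * (((n + 1) * c - n) ^ 2 - (1 + a) ^ 2 * c) := by
      rw [hA, hB, hC]; ring
    rw [this]
    exact mul_nonneg (by positivity) (by linarith)
  have hquad : 0 ≤ A * y ^ 2 + B * y * G + C * G ^ 2 := by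
    have : 0 ≤ 4 * C * (A * y ^ 2 + B * y * G + C * G ^ 2) := by
      nlinarith [mul_nonneg hdisc (sq_nonneg y), sq_nonneg (B * y + 2 * C * G)]
    exact nonneg_of_mul_nonneg_right this (by positivity)
  have hcoef : 0 ≤ (n + 1) * ((n + 1) * c - n) := by
    have : 0 ≤ (n + 1) * c - n := by nlinarith
    positivity
  have hslack := mul_nonneg hcoef (neg_nonneg.2 hyang)
  rw [← sub_nonneg]
  have key : c * ((1 + a / 2) * G ^ 2 - T) -
      ((1 + a / 2) * ((n * G + (G + y)) / (n + 1)) ^ 2 - (n * T + (G + y) ^ 2) / (n + 1)) =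
      ((A * y ^ 2 + B * y * G + C * G ^ 2) + (n + 1) * ((n + 1) * c - n) *
        -((G + y) ^ 2 - (2 + a) * G * (G + y) + (1 + a) * T)) / ((1 + a) * (n + 1) ^ 2) := by
    rw [hA, hB, hC]; field_simp; ring
  rw [key]
  positivity

/-- The Cheng–Yang recursion formula: for a nondecreasing sequence of positive
reals satisfying the Yang-type inequality with parameter `t > 0`, the sequence
`k ↦ F k / k ^ (4/t)` is nonincreasing. Here the sequence is `1`-indexed:
`μ i` for `i ≥ 1` denotes `μ_i`. -/
theorem cheng_yang_recursion_formula
    (t : ℝ) (ht : 0 < t) (μ : ℕ → ℝ)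
    (hpos : ∀ i, 1 ≤ i → 0 < μ i)
    (hmono : ∀ i j, 1 ≤ i → i ≤ j → μ i ≤ μ j)
    (hyang : ∀ k, 1 ≤ k →
      ∑ i ∈ Finset.Icc 1 k, (μ (k + 1) - μ i) ^ 2 ≤
        (4 / t) * ∑ i ∈ Finset.Icc 1 k, μ i * (μ (k + 1) - μ i))
    (G T F : ℕ → ℝ)
    (hG : ∀ k, G k = (1 / (k : ℝ)) * ∑ i ∈ Finset.Icc 1 k, μ i)
    (hT : ∀ k, T k = (1 / (k : ℝ)) * ∑ i ∈ Finset.Icc 1 k, (μ i) ^ 2)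
    (hF : ∀ k, F k = (1 + 2 / t) * (G k) ^ 2 - T k) :
    ∀ k ℓ : ℕ, 1 ≤ k → 1 ≤ ℓ →
      F (k + ℓ) / ((k : ℝ) + (ℓ : ℝ)) ^ ((4 : ℝ) / t) ≤
        F k / (k : ℝ) ^ ((4 : ℝ) / t) := by
  have step : ∀ k : ℕ, 1 ≤ k →
      F (k + 1) / ((k + 1 : ℕ) : ℝ) ^ ((4 : ℝ) / t) ≤ F k / (k : ℝ) ^ ((4 : ℝ) / t) := by
    intro k hk
    have hn : (0 : ℝ) < k := by exact_mod_cast hk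
    have ha : 0 < 4 / t := by positivity
    have hR : 1 < ((k : ℝ) + 1) / k := by rw [one_lt_div hn]; linarith
    have hb : 1 + 2 / t = 1 + 4 / t / 2 := by ring
    have hsum : ∑ i ∈ Finset.Icc 1 k, μ i = k * G k := by rw [hG]; field_simp
    have hsq : ∑ i ∈ Finset.Icc 1 k, μ i ^ 2 = k * T k := by rw [hT]; field_simp
    have hG' : G (k + 1) = (k * G k + μ (k + 1)) / (k + 1) := by
      rw [hG (k + 1), Finset.sum_Icc_succ_top (by omega), hsum]; push_cast; ring
    have hT' : T (k + 1) = (k * T k + μ (k + 1) ^ 2) / (k + 1) := by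
      rw [hT (k + 1), Finset.sum_Icc_succ_top (by omega), hsq]; push_cast; ring
    have hY := hyang k hk
    have hleft : ∑ i ∈ Finset.Icc 1 k, (μ (k + 1) - μ i) ^ 2 =
        k * (μ (k + 1) ^ 2 - 2 * μ (k + 1) * G k + T k) := by
      simp only [sub_sq, Finset.sum_add_distrib, Finset.sum_sub_distrib, ← Finset.mul_sum,
        hsum, hsq, Finset.sum_const, Nat.card_Icc, nsmul_eq_mul, Nat.add_sub_cancel]
      ring
    have hright : ∑ i ∈ Finset.Icc 1 k, μ i * (μ (k + 1) - μ i) =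
        k * (G k * μ (k + 1) - T k) := by
      simp only [mul_sub, ← pow_two, Finset.sum_sub_distrib, ← Finset.sum_mul, hsum, hsq]
      ring
    rw [hleft, hright] at hY
    rw [hF, hF, hG', hT', hb]
    generalize 4 / t = a at *
    have hY' : μ (k + 1) ^ 2 - (2 + a) * G k * μ (k + 1) + (1 + a) * T k ≤ 0 := by
      refine nonpos_of_mul_nonpos_right (a := (k : ℝ)) ?_ hn
      linarith
    have hcn : (1 + a) ^ 2 * (((k : ℝ) + 1) / k) ^ a ≤
        (((k : ℝ) + 1) * (((k : ℝ) + 1) / k) ^ a - k) ^ 2 := by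
      have h := mul_sub_one_mul_rpow_half_le hR.le ha.le
      have hz : (((k : ℝ) + 1) / k) ^ a = ((((k : ℝ) + 1) / k) ^ (a / 2)) ^ 2 := by
        rw [← Real.rpow_natCast, ← Real.rpow_mul (by positivity)]; norm_num
      have hzpos : 0 ≤ (((k : ℝ) + 1) / k) ^ (a / 2) := by positivity
      rw [hz] at h ⊢
      generalize (((k : ℝ) + 1) / k) ^ (a / 2) = z at *
      have h' := mul_le_mul_of_nonneg_left h hn.le
      have e₁ : (k : ℝ) * ((1 + a) * (((k : ℝ) + 1) / k - 1) * z) = (1 + a) * z := by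
        field_simp; ring
      have e₂ : (k : ℝ) * (((k : ℝ) + 1) / k * z ^ 2 - 1) = (k + 1) * z ^ 2 - k := by
        field_simp
      rw [e₁, e₂] at h'
      rw [← mul_pow]
      exact pow_le_pow_left₀ (by positivity) h' 2
    have h := yang_step ha hn (Real.one_lt_rpow hR ha) hcn hY'
    rw [Real.div_rpow (by positivity) hn.le] at h
    push_cast
    rw [div_le_iff₀ (by positivity)]
    exact h.trans_eq (by ring)
  intro k ℓ hk _
  rw [← Nat.cast_add]
  exact Nat.le_induction (m := k)
    (P := fun m _ => F m / (m : ℝ) ^ ((4 : ℝ) / t) ≤ F k / (k : ℝ) ^ ((4 : ℝ) / t))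
    le_rfl (fun m hm ih => (step m (hk.trans hm)).trans ih) (k + ℓ) (Nat.le_add_right k ℓ)
end

section
/- Let t > 0 be a real number and let μ_1 ≤ μ_2 ≤ ⋯ be a nondecreasing sequence of positive real numbers satisfying the Yang-type inequality with parameter t. Then for every integer k ≥ 1, μ_{k+1} ≤ (1 + 4/t) k^{2/t} μ_1. -/
theorem Real.mul_sinh_le_sinh_mul {b s : ℝ} (hb : 1 ≤ b) (hs : 0 ≤ s) :
    b * Real.sinh s ≤ Real.sinh (b * s) := by
  have hderiv : ∀ x : ℝ, HasDerivAt (fun x => Real.sinh (b * x) - b * Real.sinh x)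
      (Real.cosh (b * x) * (b * 1) - b * Real.cosh x) x := fun x =>
    (((hasDerivAt_id x).const_mul b).sinh).sub ((Real.hasDerivAt_sinh x).const_mul b)
  have hmono : MonotoneOn (fun x => Real.sinh (b * x) - b * Real.sinh x) (Set.Ici 0) := by
    refine monotoneOn_of_deriv_nonneg (convex_Ici 0)
      (fun x _ => (hderiv x).continuousAt.continuousWithinAt)
      (fun x _ => (hderiv x).differentiableAt.differentiableWithinAt) fun x hx => ?_
    rw [interior_Ici, Set.mem_Ioi] at hx
    rw [(hderiv x).deriv]
    have hcosh : Real.cosh x ≤ Real.cosh (b * x) := by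
      rw [Real.cosh_le_cosh, abs_of_pos hx, abs_of_pos (by positivity)]
      nlinarith
    nlinarith
  have h := hmono Set.self_mem_Ici hs hs
  simp only [mul_zero, Real.sinh_zero, sub_self] at h
  linarith

theorem sq_mul_one_add_inv_rpow_le {k b : ℝ} (hk : 0 < k) (hb : 1 ≤ b) :
    b ^ 2 * (1 + 1 / k) ^ b ≤ k * (k + 1) * ((1 + 1 / k) ^ b - 1) ^ 2 := by
  have hbase : 0 < 1 + 1 / k := by positivity
  set s := Real.log (1 + 1 / k) / 2 with hs_def
  have hs : 0 ≤ s := div_nonneg (Real.log_nonneg (by simp [hk.le])) zero_le_two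
  have hsinh : ∀ x : ℝ, 4 * Real.sinh x ^ 2 * Real.exp (2 * x) = (Real.exp (2 * x) - 1) ^ 2 := by
    intro x
    rw [Real.sinh_eq, two_mul, Real.exp_add, Real.exp_neg]
    field_simp
    ring
  have hexp : Real.exp (2 * s) = 1 + 1 / k := by
    rw [hs_def, mul_div_cancel₀ _ two_ne_zero, Real.exp_log hbase]
  have hpow : (1 + 1 / k) ^ b = Real.exp (2 * (b * s)) := by
    rw [Real.rpow_def_of_pos hbase, hs_def]
    congr 1
    ring
  have hsq : 4 * Real.sinh s ^ 2 * (k * (k + 1)) = 1 := by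
    have h := hsinh s
    rw [hexp] at h
    field_simp at h
    linarith
  have hle : (b * Real.sinh s) ^ 2 ≤ Real.sinh (b * s) ^ 2 :=
    pow_le_pow_left₀ (mul_nonneg (by linarith) (Real.sinh_nonneg_iff.mpr hs))
      (Real.mul_sinh_le_sinh_mul hb hs) 2
  rw [hpow, ← hsinh]
  calc b ^ 2 * Real.exp (2 * (b * s))
      = 4 * (k * (k + 1)) * Real.exp (2 * (b * s)) * (b * Real.sinh s) ^ 2 := by
        linear_combination (-(b ^ 2 * Real.exp (2 * (b * s)))) * hsq
    _ ≤ 4 * (k * (k + 1)) * Real.exp (2 * (b * s)) * Real.sinh (b * s) ^ 2 := by gcongr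
    _ = _ := by ring

/-- Here `L` and `T` are the means of the first `k` terms and of their squares, `x` is the next term,
and the hypothesis `hyang` is the Yang-type inequality with parameter `2 / a`. -/
theorem yang_functional_succ_le {k a c L T x : ℝ} (hk : 0 < k) (ha : 0 < a)
    (hpos : 0 < (k + 1) ^ 2 * c - k * (k + 1))
    (hc : (1 + 2 * a) ^ 2 * ((k + 1) ^ 2 * c) ≤ ((k + 1) ^ 2 * c - k * (k + 1)) ^ 2)
    (hyang : x ^ 2 - 2 * (1 + a) * L * x + (1 + 2 * a) * T ≤ 0) :
    (1 + a) * ((k * L + x) / (k + 1)) ^ 2 - (k * T + x ^ 2) / (k + 1) ≤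
      c * ((1 + a) * L ^ 2 - T) := by
  obtain ⟨D, hD⟩ : ∃ D, D = (k + 1) ^ 2 * c - k * (k + 1) := ⟨_, rfl⟩
  have hcD : (k + 1) ^ 2 * c = D + k * (k + 1) := by linarith
  rw [← hD] at hpos
  rw [← hD, hcD] at hc
  have hD_lower : (1 + 2 * a) ^ 2 ≤ D := by
    have : 0 ≤ (1 + 2 * a) ^ 2 * (k * (k + 1)) := by positivity
    nlinarith
  have hlead : 0 < D - (1 + 2 * a) * (a - k) := by nlinarith [mul_pos ha hk]
  have hquad : 0 ≤ (D - (1 + 2 * a) * (a - k)) * x ^ 2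
      - 2 * ((1 + a) * (D + (1 + 2 * a) * k)) * L * x
      + (1 + a) * (1 + 2 * a) * (D + k) * L ^ 2 := by
    refine nonneg_of_mul_nonneg_right ?_ hlead
    have hdisc : 0 ≤ (1 + a) * a * (D ^ 2 - (1 + 2 * a) ^ 2 * (D + k * (k + 1))) * L ^ 2 :=
      mul_nonneg (mul_nonneg (by positivity) (by linarith)) (sq_nonneg L)
    linear_combination hdisc + sq_nonneg
      ((D - (1 + 2 * a) * (a - k)) * x - (1 + a) * (D + (1 + 2 * a) * k) * L)
  have hD_yang := mul_nonneg hpos.le (neg_nonneg.mpr hyang)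
  have hscaled : 0 ≤ (1 + 2 * a) * ((D + k * (k + 1)) * ((1 + a) * L ^ 2 - T)
      - ((1 + a) * (k * L + x) ^ 2 - (k + 1) * (k * T + x ^ 2))) := by
    linear_combination hquad + hD_yang
  have hdiff := nonneg_of_mul_nonneg_right hscaled (by positivity)
  have hleft : (1 + a) * ((k * L + x) / (k + 1)) ^ 2 - (k * T + x ^ 2) / (k + 1) =
      ((1 + a) * (k * L + x) ^ 2 - (k + 1) * (k * T + x ^ 2)) / (k + 1) ^ 2 := by
    field_simp
  rw [hleft, div_le_iff₀ (by positivity)]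
  linear_combination hdiff - ((1 + a) * L ^ 2 - T) * hcD

theorem yang_functional_succ_le_rpow {k a L T x : ℝ} (hk : 0 < k) (ha : 0 < a)
    (hyang : x ^ 2 - 2 * (1 + a) * L * x + (1 + 2 * a) * T ≤ 0) :
    (1 + a) * ((k * L + x) / (k + 1)) ^ 2 - (k * T + x ^ 2) / (k + 1) ≤
      (1 + 1 / k) ^ (2 * a) * ((1 + a) * L ^ 2 - T) := by
  have hbase : 0 < 1 + 1 / k := by positivity
  have hy : (k + 1) ^ 2 * (1 + 1 / k) ^ (2 * a) = k * (k + 1) * (1 + 1 / k) ^ (1 + 2 * a) := by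
    rw [Real.rpow_add hbase, Real.rpow_one]
    field_simp
  have hone : 1 < (1 + 1 / k) ^ (1 + 2 * a) :=
    Real.one_lt_rpow (by simp [hk]) (by linarith)
  have hkk : 0 < k * (k + 1) := by positivity
  refine yang_functional_succ_le hk ha ?_ ?_ hyang
  · rw [hy]
    nlinarith
  · rw [hy]
    have h := mul_le_mul_of_nonneg_left
      (sq_mul_one_add_inv_rpow_le hk (show 1 ≤ 1 + 2 * a by linarith)) hkk.le
    linear_combination h

/-- For a nondecreasing sequence of positive reals satisfying the Yang-type
inequality with parameter `t > 0`, one has `μ_{k+1} ≤ (1 + 4/t) k^(2/t) μ₁`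
for all `k ≥ 1`. The sequence is `1`-indexed: `μ i` for `i ≥ 1` denotes `μ_i`. -/
theorem cheng_yang_eigenvalue_upper_bound
    (t : ℝ) (ht : 0 < t) (μ : ℕ → ℝ)
    (hpos : ∀ i, 1 ≤ i → 0 < μ i)
    (hmono : ∀ i j, 1 ≤ i → i ≤ j → μ i ≤ μ j)
    (hyang : ∀ k, 1 ≤ k →
      ∑ i ∈ Finset.Icc 1 k, (μ (k + 1) - μ i) ^ 2 ≤
        (4 / t) * ∑ i ∈ Finset.Icc 1 k, μ i * (μ (k + 1) - μ i)) :
    ∀ k, 1 ≤ k → μ (k + 1) ≤ (1 + 4 / t) * (k : ℝ) ^ ((2 : ℝ) / t) * μ 1 := by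
  set a := 2 / t with ha_def
  have ha : 0 < a := by positivity
  have h4 : 4 / t = 2 * a := by rw [ha_def]; ring
  rw [h4] at hyang ⊢
  set L : ℕ → ℝ := fun k => (∑ i ∈ Finset.Icc 1 k, μ i) / k with hL
  set T : ℕ → ℝ := fun k => (∑ i ∈ Finset.Icc 1 k, μ i ^ 2) / k with hT
  have hmean : ∀ k, 1 ≤ k →
      μ (k + 1) ^ 2 - 2 * (1 + a) * L k * μ (k + 1) + (1 + 2 * a) * T k ≤ 0 := by
    intro k hk
    have hk0 : (0 : ℝ) < k := by exact_mod_cast hk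
    have h := hyang k hk
    have hsq : ∑ i ∈ Finset.Icc 1 k, (μ (k + 1) - μ i) ^ 2 =
        k * μ (k + 1) ^ 2 - 2 * μ (k + 1) * ∑ i ∈ Finset.Icc 1 k, μ i
          + ∑ i ∈ Finset.Icc 1 k, μ i ^ 2 := by
      simp [sub_sq, Finset.sum_add_distrib, Finset.sum_sub_distrib, Finset.mul_sum]
    have hprod : ∑ i ∈ Finset.Icc 1 k, μ i * (μ (k + 1) - μ i) =
        μ (k + 1) * ∑ i ∈ Finset.Icc 1 k, μ i - ∑ i ∈ Finset.Icc 1 k, μ i ^ 2 := by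
      rw [Finset.mul_sum, ← Finset.sum_sub_distrib]
      exact Finset.sum_congr rfl fun i _ => by ring
    rw [hsq, hprod] at h
    have hLk : ∑ i ∈ Finset.Icc 1 k, μ i = k * L k := by simp only [hL]; field_simp
    have hTk : ∑ i ∈ Finset.Icc 1 k, μ i ^ 2 = k * T k := by simp only [hT]; field_simp
    rw [hLk, hTk] at h
    refine nonpos_of_mul_nonpos_right (a := (k : ℝ)) ?_ hk0
    linear_combination h
  have hgrowth : ∀ k : ℕ, 1 ≤ k →
      (1 + a) * L k ^ 2 - T k ≤ (k : ℝ) ^ (2 * a) * (a * μ 1 ^ 2) := by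
    intro k hk
    induction k, hk using Nat.le_induction with
    | base =>
      simp only [hL, hT, Finset.Icc_self, Finset.sum_singleton, Nat.cast_one, div_one,
        Real.one_rpow]
      linarith
    | succ k hk ih =>
      have hk0 : (0 : ℝ) < k := by exact_mod_cast hk
      have hLs : L (k + 1) = (k * L k + μ (k + 1)) / (k + 1) := by
        simp only [hL, Finset.sum_Icc_succ_top (Nat.le_add_left 1 k), Nat.cast_add, Nat.cast_one]
        field_simp
      have hTs : T (k + 1) = (k * T k + μ (k + 1) ^ 2) / (k + 1) := by
        simp only [hT, Finset.sum_Icc_succ_top (Nat.le_add_left 1 k), Nat.cast_add, Nat.cast_one]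
        field_simp
      have hbase : (0 : ℝ) < 1 + 1 / k := by positivity
      rw [hLs, hTs]
      calc _ ≤ (1 + 1 / (k : ℝ)) ^ (2 * a) * ((1 + a) * L k ^ 2 - T k) :=
            yang_functional_succ_le_rpow hk0 ha (hmean k hk)
        _ ≤ (1 + 1 / (k : ℝ)) ^ (2 * a) * ((k : ℝ) ^ (2 * a) * (a * μ 1 ^ 2)) := by gcongr
        _ = _ := by
            rw [← mul_assoc, ← Real.mul_rpow hbase.le hk0.le]
            congr 2
            push_cast
            field_simp
  intro k hk
  have hμ := hpos 1 le_rfl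
  have hpow : (k : ℝ) ^ (2 * a) = ((k : ℝ) ^ a) ^ 2 := by
    rw [mul_comm, Real.rpow_mul (Nat.cast_nonneg k), Real.rpow_two]
  refine (pow_le_pow_iff_left₀ (hpos _ (by lia)).le (by positivity) two_ne_zero).mp ?_
  refine le_of_mul_le_mul_left ?_ ha
  have hF := mul_le_mul_of_nonneg_left (hgrowth k hk) (sq_nonneg (1 + 2 * a))
  rw [hpow] at hF
  have hb := mul_nonneg (show 0 ≤ 1 + 2 * a by positivity) (neg_nonneg.mpr (hmean k hk))
  have hsq := mul_nonneg (show 0 ≤ 1 + a by positivity)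
    (sq_nonneg (μ (k + 1) - (1 + 2 * a) * L k))
  linear_combination hF + hb + hsq
end

section
/- Let t > 0 be a real number, let k ≥ 1 be an integer, and let μ_1 ≤ μ_2 ≤ ⋯ ≤ μ_{k+1} be positive real numbers satisfying ∑_{i=1}^k (μ_{k+1} − μ_i)^2 ≤ (4/t) ∑_{i=1}^k μ_i (μ_{k+1} − μ_i). Then (μ_{k+1} − (1 + 2/t) G_k)^2 ≤ (1 + 4/t) F_k − (2/t)(1 + 2/t) G_k^2, where G_k = (1/k)∑_{i=1}^k μ_i, T_k = (1/k)∑_{i=1}^k μ_i^2 and F_k = (1 + 2/t) G_k^2 − T_k. -/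
/-- For positive reals `μ₁ ≤ ⋯ ≤ μ_{k+1}` satisfying the Yang-type inequality
with parameter `t > 0` at level `k`, one has
`(μ_{k+1} − (1 + 2/t) G_k)² ≤ (1 + 4/t) F_k − (2/t)(1 + 2/t) G_k²`.
The family is `1`-indexed: `μ i` for `1 ≤ i ≤ k + 1` denotes `μ_i`. -/
theorem yang_quadratic_consequence
    (t : ℝ) (ht : 0 < t) (k : ℕ) (hk : 1 ≤ k) (μ : ℕ → ℝ)
    (hpos : ∀ i, 1 ≤ i → i ≤ k + 1 → 0 < μ i)
    (hmono : ∀ i j, 1 ≤ i → i ≤ j → j ≤ k + 1 → μ i ≤ μ j)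
    (hyang : ∑ i ∈ Finset.Icc 1 k, (μ (k + 1) - μ i) ^ 2 ≤
      (4 / t) * ∑ i ∈ Finset.Icc 1 k, μ i * (μ (k + 1) - μ i))
    (G T F : ℝ)
    (hG : G = (1 / (k : ℝ)) * ∑ i ∈ Finset.Icc 1 k, μ i)
    (hT : T = (1 / (k : ℝ)) * ∑ i ∈ Finset.Icc 1 k, (μ i) ^ 2)
    (hF : F = (1 + 2 / t) * G ^ 2 - T) :
    (μ (k + 1) - (1 + 2 / t) * G) ^ 2 ≤
      (1 + 4 / t) * F - (2 / t) * (1 + 2 / t) * G ^ 2 := by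
  have hk0 : (0 : ℝ) < k := by exact_mod_cast hk
  have hS : ∑ i ∈ Finset.Icc 1 k, μ i = k * G := by rw [hG]; field_simp
  have hQ : ∑ i ∈ Finset.Icc 1 k, (μ i) ^ 2 = k * T := by rw [hT]; field_simp
  have hleft : ∑ i ∈ Finset.Icc 1 k, (μ (k + 1) - μ i) ^ 2 =
      k * (μ (k + 1) ^ 2 - 2 * μ (k + 1) * G + T) := by
    simp only [sub_sq, Finset.sum_add_distrib, Finset.sum_sub_distrib, ← Finset.mul_sum, hS, hQ,
      Finset.sum_const, Nat.card_Icc, nsmul_eq_mul, Nat.add_sub_cancel]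
    ring
  have hright : ∑ i ∈ Finset.Icc 1 k, μ i * (μ (k + 1) - μ i) = k * (μ (k + 1) * G - T) := by
    simp only [mul_sub, ← sq, Finset.sum_sub_distrib, ← Finset.sum_mul, hS, hQ]
    ring
  rw [hleft, hright, mul_left_comm] at hyang
  have hmean := le_of_mul_le_mul_left hyang hk0
  rw [hF]
  linear_combination hmean
end

section
/- Let t > 0 be a real number, let k ≥ 1 be an integer, and let μ_1 ≤ μ_2 ≤ ⋯ ≤ μ_{k+1} be positive real numbers satisfying ∑_{i=1}^k (μ_{k+1} − μ_i)^2 ≤ (4/t) ∑_{i=1}^k μ_i (μ_{k+1} − μ_i). Then μ_{k+1}^2 ≤ (t/2)(1 + 4/t)^2 F_k, where F_k = (1 + 2/t) G_k^2 − T_k with G_k = (1/k)∑_{i=1}^k μ_i and T_k = (1/k)∑_{i=1}^k μ_i^2. -/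
/-- For positive reals `μ₁ ≤ ⋯ ≤ μ_{k+1}` satisfying the Yang-type inequality
with parameter `t > 0` at level `k`, one has `μ_{k+1}² ≤ (t/2)(1 + 4/t)² F_k`.
The family is `1`-indexed: `μ i` for `1 ≤ i ≤ k + 1` denotes `μ_i`. -/
theorem yang_squared_upper_bound
    (t : ℝ) (ht : 0 < t) (k : ℕ) (hk : 1 ≤ k) (μ : ℕ → ℝ)
    (hpos : ∀ i, 1 ≤ i → i ≤ k + 1 → 0 < μ i)
    (hmono : ∀ i j, 1 ≤ i → i ≤ j → j ≤ k + 1 → μ i ≤ μ j)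
    (hyang : ∑ i ∈ Finset.Icc 1 k, (μ (k + 1) - μ i) ^ 2 ≤
      (4 / t) * ∑ i ∈ Finset.Icc 1 k, μ i * (μ (k + 1) - μ i))
    (G T F : ℝ)
    (hG : G = (1 / (k : ℝ)) * ∑ i ∈ Finset.Icc 1 k, μ i)
    (hT : T = (1 / (k : ℝ)) * ∑ i ∈ Finset.Icc 1 k, (μ i) ^ 2)
    (hF : F = (1 + 2 / t) * G ^ 2 - T) :
    (μ (k + 1)) ^ 2 ≤ (t / 2) * (1 + 4 / t) ^ 2 * F := by
  have hk0 : (0 : ℝ) < k := by exact_mod_cast hk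
  have hsum : ∑ i ∈ Finset.Icc 1 k, μ i = k * G := by
    rw [hG]; field_simp
  have hsumsq : ∑ i ∈ Finset.Icc 1 k, μ i ^ 2 = k * T := by
    rw [hT]; field_simp
  set x := μ (k + 1)
  have hleft : ∑ i ∈ Finset.Icc 1 k, (x - μ i) ^ 2 = k * (x ^ 2 - 2 * x * G + T) := by
    simp only [sub_sq, Finset.sum_add_distrib, Finset.sum_sub_distrib, ← Finset.mul_sum,
      Finset.sum_const, Nat.card_Icc, hsum, hsumsq, nsmul_eq_mul, Nat.add_sub_cancel]
    ring
  have hright : ∑ i ∈ Finset.Icc 1 k, μ i * (x - μ i) = k * (x * G - T) := by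
    simp only [mul_sub, Finset.sum_sub_distrib, ← Finset.sum_mul, ← sq, hsum, hsumsq]
    ring
  rw [hleft, hright, mul_left_comm] at hyang
  have hquad : x ^ 2 - 2 * x * G + T ≤ 4 / t * (x * G - T) := le_of_mul_le_mul_left hyang hk0
  have hscaled := mul_le_mul_of_nonneg_left hquad (by positivity : 0 ≤ t / 2 * (1 + 4 / t))
  have hsquare : 0 ≤ t / 2 * (1 + 2 / t) * ((1 + 4 / t) * G - x) ^ 2 := by positivity
  have hidentity : t / 2 * (1 + 4 / t) ^ 2 * F - x ^ 2 =
      t / 2 * (1 + 2 / t) * ((1 + 4 / t) * G - x) ^ 2 +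
        (t / 2 * (1 + 4 / t) * (4 / t * (x * G - T)) -
          t / 2 * (1 + 4 / t) * (x ^ 2 - 2 * x * G + T)) := by
    rw [hF]
    field_simp
    ring
  linarith
end

section
/- Let t > 0 be a real number, k ≥ 1 an integer, and let 0 < λ_1 ≤ λ_2 ≤ ⋯ ≤ λ_k ≤ Λ be real numbers satisfying Yang's first inequality ∑_{i=1}^k (Λ − λ_i)^2 ≤ (4/t) ∑_{i=1}^k (Λ − λ_i) λ_i. Then Yang's second inequality holds: Λ ≤ (1 + 4/t) (1/k) ∑_{i=1}^k λ_i. -/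
/-- The mean form of Yang's argument over an arbitrary finite index set: no ordering of the
family is needed, only that its sum is nonnegative and that `L` is at least its mean. -/
theorem card_mul_le_of_sum_sq_sub_le {ι : Type*} (s : Finset ι) (f : ι → ℝ) {L c : ℝ}
    (hc : 0 ≤ c) (hf : 0 ≤ ∑ i ∈ s, f i) (hL : ∑ i ∈ s, f i ≤ s.card * L)
    (h : ∑ i ∈ s, (L - f i) ^ 2 ≤ c * ∑ i ∈ s, (L - f i) * f i) :
    s.card * L ≤ (1 + c) * ∑ i ∈ s, f i := by
  have hsq : ∑ i ∈ s, (L - f i) ^ 2 =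
      s.card * L ^ 2 - 2 * L * ∑ i ∈ s, f i + ∑ i ∈ s, f i ^ 2 := by
    simp only [sub_sq, Finset.sum_add_distrib, Finset.sum_sub_distrib, Finset.mul_sum,
      Finset.sum_const, nsmul_eq_mul]
  have hmul : ∑ i ∈ s, (L - f i) * f i = L * ∑ i ∈ s, f i - ∑ i ∈ s, f i ^ 2 := by
    simp only [sub_mul, Finset.sum_sub_distrib, Finset.mul_sum, sq]
  have hcs : (∑ i ∈ s, f i) ^ 2 ≤ s.card * ∑ i ∈ s, f i ^ 2 := sq_sum_le_card_mul_sum_sq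
  rw [hsq, hmul] at h
  have hn : (0 : ℝ) ≤ s.card := Nat.cast_nonneg _
  generalize ∑ i ∈ s, f i = S at *
  generalize ∑ i ∈ s, f i ^ 2 = Q at *
  generalize (s.card : ℝ) = n at *
  have key : (n * L - S) * (n * L - S) ≤ (c * S) * (n * L - S) := by
    linarith [mul_le_mul_of_nonneg_left h hn,
      mul_le_mul_of_nonneg_left hcs (by linarith : 0 ≤ 1 + c)]
  rcases hL.eq_or_lt with heq | hlt
  · linarith [mul_nonneg hc hf]
  · linarith [le_of_mul_le_mul_right key (sub_pos.2 hlt)]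

/-- Yang's first inequality implies Yang's second inequality: if
`0 < λ₁ ≤ ⋯ ≤ λ_k ≤ Λ` satisfy
`∑ (Λ − λᵢ)² ≤ (4/t) ∑ (Λ − λᵢ) λᵢ`, then
`Λ ≤ (1 + 4/t) (1/k) ∑ λᵢ`. The family is `1`-indexed. -/
theorem yang_first_implies_yang_second
    (t : ℝ) (ht : 0 < t) (k : ℕ) (hk : 1 ≤ k) (lam : ℕ → ℝ) (Λ : ℝ)
    (hpos : ∀ i, 1 ≤ i → i ≤ k → 0 < lam i)
    (hmono : ∀ i j, 1 ≤ i → i ≤ j → j ≤ k → lam i ≤ lam j)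
    (hup : lam k ≤ Λ)
    (hyang1 : ∑ i ∈ Finset.Icc 1 k, (Λ - lam i) ^ 2 ≤
      (4 / t) * ∑ i ∈ Finset.Icc 1 k, (Λ - lam i) * lam i) :
    Λ ≤ (1 + 4 / t) * ((1 / (k : ℝ)) * ∑ i ∈ Finset.Icc 1 k, lam i) := by
  have hk0 : (0 : ℝ) < k := by exact_mod_cast hk
  have hle : ∑ i ∈ Finset.Icc 1 k, lam i ≤ (Finset.Icc 1 k).card * Λ := by
    rw [← nsmul_eq_mul]
    refine Finset.sum_le_card_nsmul _ _ _ fun i hi => ?_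
    obtain ⟨h1, h2⟩ := Finset.mem_Icc.1 hi
    exact (hmono i k h1 h2 le_rfl).trans hup
  have hnonneg : 0 ≤ ∑ i ∈ Finset.Icc 1 k, lam i :=
    Finset.sum_nonneg fun i hi => (hpos i (Finset.mem_Icc.1 hi).1 (Finset.mem_Icc.1 hi).2).le
  have hmain := card_mul_le_of_sum_sq_sub_le _ lam (by positivity) hnonneg hle hyang1
  rw [Nat.card_Icc, Nat.add_sub_cancel] at hmain
  rw [one_div_mul_eq_div, ← mul_div_assoc, le_div_iff₀ hk0, mul_comm Λ]
  exact hmain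
end

section
/- Let t > 0 be a real number, k ≥ 1 an integer, and let 0 < λ_1 ≤ λ_2 ≤ ⋯ ≤ λ_k < Λ be real numbers satisfying Λ ≤ (1 + 4/t) (1/k) ∑_{i=1}^k λ_i. Then the Hile–Protter inequality holds: ∑_{i=1}^k λ_i/(Λ − λ_i) ≥ t k / 4. -/
/-- Yang's second inequality implies the Hile–Protter inequality: if
`0 < λ₁ ≤ ⋯ ≤ λ_k < Λ` satisfy `Λ ≤ (1 + 4/t) (1/k) ∑ λᵢ`, then
`∑ λᵢ/(Λ − λᵢ) ≥ t k / 4`. The family is `1`-indexed. -/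
theorem yang_second_implies_hile_protter
    (t : ℝ) (ht : 0 < t) (k : ℕ) (hk : 1 ≤ k) (lam : ℕ → ℝ) (Λ : ℝ)
    (hpos : ∀ i, 1 ≤ i → i ≤ k → 0 < lam i)
    (hmono : ∀ i j, 1 ≤ i → i ≤ j → j ≤ k → lam i ≤ lam j)
    (hup : lam k < Λ)
    (hyang2 : Λ ≤ (1 + 4 / t) * ((1 / (k : ℝ)) * ∑ i ∈ Finset.Icc 1 k, lam i)) :
    ∑ i ∈ Finset.Icc 1 k, lam i / (Λ - lam i) ≥ t * (k : ℝ) / 4 := by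
  have hlt : ∀ i ∈ Finset.Icc 1 k, 0 < Λ - lam i := fun i hi ↦ by
    obtain ⟨h1, h2⟩ := Finset.mem_Icc.mp hi
    linarith [hmono i k h1 h2 le_rfl]
  have hlam : ∀ i ∈ Finset.Icc 1 k, 0 < lam i := fun i hi ↦
    hpos i (Finset.mem_Icc.mp hi).1 (Finset.mem_Icc.mp hi).2
  have hanti : AntivaryOn (fun i ↦ lam i / (Λ - lam i)) (fun i ↦ Λ - lam i)
      (Finset.Icc 1 k : Finset ℕ) := fun i hi j hj hij ↦
    div_le_div₀ (hlam i hi).le (by linarith) (hlt i hi) hij.le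
  have hcheb := hanti.card_mul_sum_le_sum_mul_sum
  rw [Finset.sum_congr rfl fun i hi ↦ div_mul_cancel₀ (lam i) (hlt i hi).ne'] at hcheb
  simp only [Finset.sum_sub_distrib, Finset.sum_const, Nat.card_Icc, Nat.add_sub_cancel,
    nsmul_eq_mul] at hcheb
  have hF : 0 ≤ ∑ i ∈ Finset.Icc 1 k, lam i / (Λ - lam i) :=
    Finset.sum_nonneg fun i hi ↦ (div_pos (hlam i hi) (hlt i hi)).le
  have hS : 0 < ∑ i ∈ Finset.Icc 1 k, lam i :=
    Finset.sum_pos hlam (Finset.nonempty_Icc.mpr hk)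
  set S := ∑ i ∈ Finset.Icc 1 k, lam i
  set F := ∑ i ∈ Finset.Icc 1 k, lam i / (Λ - lam i)
  have hk0 : (0 : ℝ) < k := by exact_mod_cast hk
  have hgap : k * Λ - S ≤ 4 / t * S := by
    have h := mul_le_mul_of_nonneg_left hyang2 hk0.le
    have hcancel : (k : ℝ) * ((1 + 4 / t) * (1 / k * S)) = (1 + 4 / t) * S := by
      field_simp
    linarith
  have hkF : (k : ℝ) ≤ F * (4 / t) :=
    le_of_mul_le_mul_right
      (by linarith [mul_le_mul_of_nonneg_left hgap hF]) hS
  rw [← mul_div_assoc, le_div_iff₀ ht] at hkF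
  linarith
end

section
/- Let n > 0 be a real number and (μ_k)_{k≥1} a nondecreasing sequence of positive real numbers tending to infinity. If for every z ≥ 0 one has R_2(z) ≤ (4/n) ∑_{k≥1} (z − μ_k)_+ μ_k, then for every z ≥ 0 one has (1 + n/4) R_2(z) ≤ z R_1(z). (In particular, ∑_{k≥1} (z − μ_k)_+ μ_k = z R_1(z) − R_2(z).) -/
/-- The Riesz mean of order `ρ` of a sequence `μ`:
`R_ρ(z) = ∑_{k≥1} (z − μ_k)₊^ρ`. The sequence is `0`-indexed, i.e. `μ k`
denotes `μ_{k+1}`. -/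
noncomputable def rieszMean (μ : ℕ → ℝ) (ρ z : ℝ) : ℝ :=
  ∑' k : ℕ, (max (z - μ k) 0) ^ ρ

/-- The Riesz means of a sequence tending to infinity are finite sums. -/
theorem summable_rieszMean {μ : ℕ → ℝ} (htend : Filter.Tendsto μ Filter.atTop Filter.atTop)
    {ρ : ℝ} (hρ : ρ ≠ 0) (z : ℝ) : Summable fun k : ℕ => (max (z - μ k) 0) ^ ρ := by
  obtain ⟨N, hN⟩ := Filter.eventually_atTop.1 (htend.eventually_ge_atTop z)
  refine summable_of_ne_finset_zero (s := Finset.range N) fun k hk => ?_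
  have hz : z ≤ μ k := hN k (by simpa using hk)
  rw [max_eq_right (sub_nonpos.2 hz), Real.zero_rpow hρ]

theorem tsum_max_sub_mul_eq {μ : ℕ → ℝ} (htend : Filter.Tendsto μ Filter.atTop Filter.atTop)
    (z : ℝ) : (∑' k : ℕ, (max (z - μ k) 0) * μ k) =
      z * rieszMean μ 1 z - rieszMean μ 2 z := by
  have h₁ := summable_rieszMean htend one_ne_zero z
  have h₂ := summable_rieszMean htend two_ne_zero z
  rw [rieszMean, rieszMean, ← tsum_mul_left, ← (h₁.mul_left z).tsum_sub h₂]
  refine tsum_congr fun k => ?_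
  rw [Real.rpow_one, Real.rpow_two]
  rcases max_cases (z - μ k) 0 with ⟨h, -⟩ | ⟨h, -⟩ <;> rw [h] <;> ring

/-- If `R₂(z) ≤ (4/n) ∑ (z − μ_k)₊ μ_k` for all `z ≥ 0`, then
`(1 + n/4) R₂(z) ≤ z R₁(z)` for all `z ≥ 0`; moreover
`∑ (z − μ_k)₊ μ_k = z R₁(z) − R₂(z)`. -/
theorem harrell_stubbe_R2_bound
    (n : ℝ) (hn : 0 < n) (μ : ℕ → ℝ)
    (hpos : ∀ k, 0 < μ k) (hmono : Monotone μ)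
    (htend : Filter.Tendsto μ Filter.atTop Filter.atTop)
    (hR2 : ∀ z : ℝ, 0 ≤ z →
      rieszMean μ 2 z ≤ (4 / n) * ∑' k : ℕ, (max (z - μ k) 0) * μ k) :
    ∀ z : ℝ, 0 ≤ z →
      (1 + n / 4) * rieszMean μ 2 z ≤ z * rieszMean μ 1 z ∧
      (∑' k : ℕ, (max (z - μ k) 0) * μ k) =
        z * rieszMean μ 1 z - rieszMean μ 2 z := by
  intro z hz
  have heq := tsum_max_sub_mul_eq htend z
  refine ⟨?_, heq⟩
  have h := hR2 z hz
  rw [heq, div_mul_eq_mul_div, le_div_iff₀ hn] at h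
  linarith
end

section
/- Let n > 0 be a real number and (μ_k)_{k≥1} a nondecreasing sequence of positive real numbers tending to infinity. If (1 + n/4) R_2(z) ≤ z R_1(z) holds for all z ≥ 0, then for every real ρ ≥ 2 and every z ≥ 0 one has R_ρ(z) ≤ (ρ/(ρ + n/2)) z R_{ρ−1}(z). -/
open MeasureTheory in
/-- Integrability of the weight `(z - t)^(a - 1)` against a continuous function. -/
theorem intervalIntegrable_sub_rpow_mul {a z w : ℝ} (ha : 0 < a) {f : ℝ → ℝ} (hf : Continuous f) :
    IntervalIntegrable (fun t => (z - t) ^ (a - 1) * f t) volume w z := by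
  have h : IntervalIntegrable (fun s : ℝ => s ^ (a - 1)) volume (z - w) (z - z) :=
    intervalIntegral.intervalIntegrable_rpow' (by linarith)
  have h' := h.comp_sub_left z
  simp only [sub_sub_cancel] at h'
  exact h'.mul_continuousOn hf.continuousOn

/-- The fractional integral of `t (t - m) - c (t - m)²` over `[m, z]`. -/
theorem integral_sub_rpow_mul_quadratic {a c m z : ℝ} (ha : 0 < a) (hmz : m ≤ z) :
    ∫ t in m..z, (z - t) ^ (a - 1) * (t * (t - m) - c * (t - m) ^ 2) =
      ((a + 2) * z * (z - m) ^ (a + 1) - (a + 2 * c) * (z - m) ^ (a + 2)) /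
        (a * (a + 1) * (a + 2)) := by
  set d := z - m with hd
  have hd0 : 0 ≤ d := by linarith
  set q : ℝ → ℝ := fun s => (z * d - c * d ^ 2) / a + (2 * c * d - (z + d)) / (a + 1) * s +
    (1 - c) / (a + 2) * s ^ 2 with hq
  rw [intervalIntegral.integral_eq_sub_of_hasDerivAt_of_le
    (f := fun t => -((z - t) ^ a * q (z - t))) hmz]
  · have e1 : d ^ (a + 1) = d ^ a * d := by
      rw [Real.rpow_add_of_nonneg hd0 ha.le zero_le_one, Real.rpow_one]
    have e2 : d ^ (a + 2) = d ^ a * d ^ 2 := by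
      rw [Real.rpow_add_of_nonneg hd0 ha.le zero_le_two, Real.rpow_two]
    simp only [sub_self, Real.zero_rpow ha.ne', ← hd, e1, e2, hq]
    field_simp
    ring
  · have : Continuous fun t : ℝ => (z - t) ^ a :=
      (continuous_const.sub continuous_id).rpow_const fun _ => Or.inr ha.le
    fun_prop
  · intro t ht
    have hs : 0 < z - t := by linarith [ht.2]
    have h1 : HasDerivAt (fun t => z - t) (-1) t := by
      simpa using (hasDerivAt_id t).const_sub z
    have h2 : HasDerivAt (fun s : ℝ => s ^ a * q s)
        (a * (z - t) ^ (a - 1) * q (z - t) + (z - t) ^ a *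
          ((2 * c * d - (z + d)) / (a + 1) + (1 - c) / (a + 2) * (2 * (z - t)))) (z - t) := by
      refine (Real.hasDerivAt_rpow_const (Or.inl hs.ne')).mul ?_
      have := (((hasDerivAt_id (z - t)).const_mul ((2 * c * d - (z + d)) / (a + 1))).const_add
        ((z * d - c * d ^ 2) / a)).add
        ((hasDerivAt_pow 2 (z - t)).const_mul ((1 - c) / (a + 2)))
      exact this.congr_deriv (by simp)
    have h3 := (h2.comp t h1).neg
    refine h3.congr_deriv ?_
    have e : (z - t) ^ a = (z - t) ^ (a - 1) * (z - t) := by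
      rw [← Real.rpow_add_one hs.ne', sub_add_cancel]
    rw [e]
    simp only [hq, hd]
    field_simp
    ring
  · exact intervalIntegrable_sub_rpow_mul ha (by fun_prop)

/-- The fractional integral of `t (t - m)₊ - c (t - m)₊²` over `[0, z]`. -/
theorem integral_sub_rpow_mul_posPart_quadratic {a c m z : ℝ} (ha : 0 < a) (hm : 0 ≤ m)
    (hz : 0 ≤ z) :
    ∫ t in 0..z, (z - t) ^ (a - 1) * (t * max (t - m) 0 - c * max (t - m) 0 ^ 2) =
      ((a + 2) * z * max (z - m) 0 ^ (a + 1) - (a + 2 * c) * max (z - m) 0 ^ (a + 2)) /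
        (a * (a + 1) * (a + 2)) := by
  have hzero : ∀ w, 0 ≤ w → w ≤ m →
      ∫ t in 0..w, (z - t) ^ (a - 1) * (t * max (t - m) 0 - c * max (t - m) 0 ^ 2) = 0 := by
    intro w hw hwm
    refine (intervalIntegral.integral_congr (g := fun _ => (0 : ℝ)) fun t ht => ?_).trans (by simp)
    rw [Set.uIcc_of_le hw] at ht
    simp [max_eq_right (show t - m ≤ 0 by linarith [ht.2])]
  rcases le_total z m with hzm | hmz
  · rw [hzero z hz hzm, max_eq_right (by linarith), Real.zero_rpow (by linarith),
      Real.zero_rpow (by linarith)]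
    simp
  · have hint : ∀ w, IntervalIntegrable (fun t => (z - t) ^ (a - 1) *
        (t * max (t - m) 0 - c * max (t - m) 0 ^ 2)) MeasureTheory.volume w z :=
      fun w => intervalIntegrable_sub_rpow_mul ha (by fun_prop)
    rw [← intervalIntegral.integral_add_adjacent_intervals ((hint 0).trans (hint m).symm) (hint m),
      hzero m hm le_rfl, zero_add, max_eq_left (by linarith), ← integral_sub_rpow_mul_quadratic ha hmz]
    refine intervalIntegral.integral_congr fun t ht => ?_
    rw [Set.uIcc_of_le hmz] at ht
    simp [max_eq_left (show 0 ≤ t - m by linarith [ht.1])]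

/-- Below `z` the Riesz means are finite sums over a common index set. -/
theorem exists_rieszMean_eq_sum_range {μ : ℕ → ℝ}
    (htend : Filter.Tendsto μ Filter.atTop Filter.atTop) (z : ℝ) :
    ∃ N, ∀ ρ, 0 < ρ → ∀ t ≤ z,
      rieszMean μ ρ t = ∑ k ∈ Finset.range N, max (t - μ k) 0 ^ ρ := by
  obtain ⟨N, hN⟩ := Filter.eventually_atTop.1 (htend.eventually_ge_atTop z)
  refine ⟨N, fun ρ hρ t ht => tsum_eq_sum fun k hk => ?_⟩
  have := hN k (by simpa using hk)
  rw [max_eq_right (by linarith), Real.zero_rpow hρ.ne']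

/-- If `(1 + n/4) R₂(z) ≤ z R₁(z)` for all `z ≥ 0`, then for every `ρ ≥ 2`
and `z ≥ 0` one has `R_ρ(z) ≤ (ρ/(ρ + n/2)) z R_{ρ−1}(z)`. -/
theorem harrell_stubbe_riesz_bound
    (n : ℝ) (hn : 0 < n) (μ : ℕ → ℝ)
    (hpos : ∀ k, 0 < μ k) (hmono : Monotone μ)
    (htend : Filter.Tendsto μ Filter.atTop Filter.atTop)
    (h2 : ∀ z : ℝ, 0 ≤ z → (1 + n / 4) * rieszMean μ 2 z ≤ z * rieszMean μ 1 z) :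
    ∀ ρ : ℝ, 2 ≤ ρ → ∀ z : ℝ, 0 ≤ z →
      rieszMean μ ρ z ≤ (ρ / (ρ + n / 2)) * z * rieszMean μ (ρ - 1) z := by
  intro ρ hρ z hz
  have hρn : 0 < ρ + n / 2 := by linarith
  suffices h : (ρ + n / 2) * rieszMean μ ρ z ≤ ρ * z * rieszMean μ (ρ - 1) z by
    rw [div_mul_eq_mul_div, div_mul_eq_mul_div, le_div_iff₀ hρn]
    linarith
  rcases hρ.eq_or_lt with rfl | hρ
  · have := h2 z hz
    norm_num
    linarith
  obtain ⟨a, rfl⟩ : ∃ a, ρ = a + 2 := ⟨ρ - 2, by ring⟩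
  have ha : 0 < a := by linarith
  obtain ⟨N, hN⟩ := exists_rieszMean_eq_sum_range htend z
  have hnonneg : 0 ≤ ∫ t in 0..z, ∑ k ∈ Finset.range N,
      (z - t) ^ (a - 1) * (t * max (t - μ k) 0 - (1 + n / 4) * max (t - μ k) 0 ^ 2) := by
    refine intervalIntegral.integral_nonneg hz fun t ht => ?_
    have h := h2 t ht.1
    rw [hN 2 two_pos t ht.2, hN 1 one_pos t ht.2] at h
    simp only [Real.rpow_one, Real.rpow_two] at h
    rw [← Finset.mul_sum, Finset.sum_sub_distrib, ← Finset.mul_sum, ← Finset.mul_sum]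
    exact mul_nonneg (Real.rpow_nonneg (by linarith [ht.2]) _) (by linarith)
  rw [intervalIntegral.integral_finsetSum
      fun k _ => intervalIntegrable_sub_rpow_mul ha (by fun_prop),
    Finset.sum_congr rfl fun k _ => integral_sub_rpow_mul_posPart_quadratic ha (hpos k).le hz,
    ← Finset.sum_div, Finset.sum_sub_distrib, ← Finset.mul_sum, ← Finset.mul_sum,
    ← hN (a + 1) (by linarith) z le_rfl, ← hN (a + 2) (by linarith) z le_rfl,
    le_div_iff₀ (by positivity)] at hnonneg
  rw [show a + 2 - 1 = a + 1 by ring]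
  linarith
end

section
/- Let n > 0 and ρ ≥ 2 be real numbers and (μ_k)_{k≥1} a nondecreasing sequence of positive real numbers tending to infinity. If R_ρ(z) ≤ (ρ/(ρ + n/2)) z R_{ρ−1}(z) holds for all z > 0, then the function z ↦ R_ρ(z)/z^{ρ + n/2} is nondecreasing on (0, ∞). -/
/-- The truncated power `x ↦ x₊ ^ p` with `p > 1` is differentiable, including at the origin. -/
theorem hasDerivAt_max_zero_rpow {p : ℝ} (hp : 1 < p) (x : ℝ) :
    HasDerivAt (fun y : ℝ => (max y 0) ^ p) (p * (max x 0) ^ (p - 1)) x := by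
  have hne : ∀ y : ℝ, y ≠ 0 →
      HasDerivAt (fun y : ℝ => (max y 0) ^ p) (p * (max y 0) ^ (p - 1)) y := by
    intro y hy
    rcases lt_or_gt_of_ne hy with hy | hy
    · rw [max_eq_right hy.le, Real.zero_rpow (by linarith), mul_zero]
      refine (hasDerivAt_const y (0 : ℝ)).congr_of_eventuallyEq ?_
      filter_upwards [Iio_mem_nhds hy] with t ht
      rw [max_eq_right (le_of_lt ht), Real.zero_rpow (by linarith)]
    · rw [max_eq_left hy.le]
      refine (Real.hasDerivAt_rpow_const (Or.inl hy.ne')).congr_of_eventuallyEq ?_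
      filter_upwards [Ioi_mem_nhds hy] with t ht
      rw [max_eq_left (le_of_lt ht)]
  have hcont : ∀ q : ℝ, 0 ≤ q → Continuous fun y : ℝ => (max y 0) ^ q := fun q hq =>
    (continuous_id.max continuous_const).rpow_const fun _ => Or.inr hq
  rcases eq_or_ne x 0 with rfl | hx
  · exact hasDerivAt_of_hasDerivAt_of_ne hne (hcont p (by linarith)).continuousAt
      ((hcont (p - 1) (by linarith)).const_mul p).continuousAt
  · exact hne x hx

/-- Below a level `Z` past which the sequence stays from index `N` on, the Riesz mean is a
finite sum. -/
theorem rieszMean_eq_sum_range {μ : ℕ → ℝ} {Z : ℝ} {N : ℕ} (hN : ∀ k, N ≤ k → Z ≤ μ k)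
    {p : ℝ} (hp : 0 < p) {z : ℝ} (hz : z ≤ Z) :
    rieszMean μ p z = ∑ k ∈ Finset.range N, (max (z - μ k) 0) ^ p := by
  refine tsum_eq_sum fun k hk => ?_
  have hk' := hN k (by simpa using hk)
  rw [max_eq_right (by linarith), Real.zero_rpow hp.ne']

/-- Differentiating a Riesz mean of order `p > 1` lowers its order by one. -/
theorem hasDerivAt_rieszMean {μ : ℕ → ℝ} (htend : Filter.Tendsto μ Filter.atTop Filter.atTop)
    {p : ℝ} (hp : 1 < p) (z : ℝ) :
    HasDerivAt (rieszMean μ p) (p * rieszMean μ (p - 1) z) z := by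
  obtain ⟨N, hN⟩ := Filter.eventually_atTop.1 (htend.eventually_ge_atTop (z + 1))
  rw [rieszMean_eq_sum_range hN (by linarith) (by linarith), Finset.mul_sum]
  have hsum : HasDerivAt (fun y => ∑ k ∈ Finset.range N, (max (y - μ k) 0) ^ p)
      (∑ k ∈ Finset.range N, p * (max (z - μ k) 0) ^ (p - 1)) z :=
    HasDerivAt.fun_sum fun k _ => (hasDerivAt_max_zero_rpow hp (z - μ k)).comp_sub_const z (μ k)
  refine hsum.congr_of_eventuallyEq ?_
  filter_upwards [Iio_mem_nhds (lt_add_one z)] with y hy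
  exact rieszMean_eq_sum_range hN (by linarith) (le_of_lt hy)

/-- If `R_ρ(z) ≤ (ρ/(ρ + n/2)) z R_{ρ−1}(z)` for all `z > 0`, then
`z ↦ R_ρ(z)/z^{ρ + n/2}` is nondecreasing on `(0, ∞)`. -/
theorem riesz_quotient_monotone
    (n ρ : ℝ) (hn : 0 < n) (hρ : 2 ≤ ρ) (μ : ℕ → ℝ)
    (hpos : ∀ k, 0 < μ k) (hmono : Monotone μ)
    (htend : Filter.Tendsto μ Filter.atTop Filter.atTop)
    (h : ∀ z : ℝ, 0 < z →
      rieszMean μ ρ z ≤ (ρ / (ρ + n / 2)) * z * rieszMean μ (ρ - 1) z) :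
    MonotoneOn (fun z : ℝ => rieszMean μ ρ z / z ^ (ρ + n / 2)) (Set.Ioi 0) := by
  have hderiv : ∀ z : ℝ, 0 < z → HasDerivAt (fun z : ℝ => rieszMean μ ρ z / z ^ (ρ + n / 2))
      ((ρ * rieszMean μ (ρ - 1) z * z ^ (ρ + n / 2) -
        rieszMean μ ρ z * ((ρ + n / 2) * z ^ (ρ + n / 2 - 1))) / (z ^ (ρ + n / 2)) ^ 2) z :=
    fun z hz => (hasDerivAt_rieszMean htend (by linarith) z).fun_div
      (Real.hasDerivAt_rpow_const (Or.inl hz.ne')) (Real.rpow_pos_of_pos hz _).ne'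
  refine monotoneOn_of_deriv_nonneg (convex_Ioi 0)
    (fun z hz => (hderiv z hz).continuousAt.continuousWithinAt)
    (fun z hz => (hderiv z (interior_subset hz)).differentiableAt.differentiableWithinAt) ?_
  intro z hz
  have hz : 0 < z := interior_subset hz
  rw [(hderiv z hz).deriv]
  refine div_nonneg (sub_nonneg.2 ?_) (sq_nonneg _)
  have hs : 0 < ρ + n / 2 := by linarith
  have hbound : (ρ + n / 2) * rieszMean μ ρ z ≤ ρ * z * rieszMean μ (ρ - 1) z := by
    calc (ρ + n / 2) * rieszMean μ ρ z
        ≤ (ρ + n / 2) * ((ρ / (ρ + n / 2)) * z * rieszMean μ (ρ - 1) z) :=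
          mul_le_mul_of_nonneg_left (h z hz) hs.le
      _ = ρ * z * rieszMean μ (ρ - 1) z := by field_simp
  have hpow : z ^ (ρ + n / 2) = z ^ (ρ + n / 2 - 1) * z := by
    rw [Real.rpow_sub_one hz.ne', div_mul_cancel₀ _ hz.ne']
  rw [hpow]
  linarith [mul_le_mul_of_nonneg_right hbound (Real.rpow_nonneg hz.le (ρ + n / 2 - 1))]
end

section
/- Karamata's Tauberian theorem: Let (λ_n)_{n∈ℕ} be a sequence of positive real numbers such that the series ∑_{n∈ℕ} e^{−λ_n t} converges for every t > 0, let r > 0 and a ∈ ℝ. Then the following are equivalent: (1) lim_{t → 0⁺} t^r ∑_{n∈ℕ} e^{−λ_n t} = a; (2) lim_{λ → ∞} λ^{−r} N(λ) = a / Γ(r + 1), where N(λ) = #{n : λ_n ≤ λ} is the counting function. -/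
open Filter Set MeasureTheory Topology

/-- The values `g (e^{-λ_n t})`, weighted by `t ^ r * e^{-λ_n t}`, sum up in the limit `t → 0⁺` to
`A` times the integral of `g (e^{-u})` against the density `e^{-u} u^{r-1}`. -/
structure KaramataTest (lam : ℕ → ℝ) (r A : ℝ) (g : ℝ → ℝ) : Prop where
  summable : ∀ t : ℝ, 0 < t →
    Summable fun n => Real.exp (-(lam n * t)) * g (Real.exp (-(lam n * t)))
  integrable : IntegrableOn (fun u : ℝ => Real.exp (-u) * u ^ (r - 1) * g (Real.exp (-u))) (Ioi 0)
  tendsto : Tendsto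
    (fun t : ℝ => t ^ r * ∑' n, Real.exp (-(lam n * t)) * g (Real.exp (-(lam n * t))))
    (𝓝[>] 0) (𝓝 (A * ∫ u in Ioi (0 : ℝ), Real.exp (-u) * u ^ (r - 1) * g (Real.exp (-u))))

namespace KaramataTest

variable {lam : ℕ → ℝ} {r A : ℝ}

theorem add {g h : ℝ → ℝ} (hg : KaramataTest lam r A g) (hh : KaramataTest lam r A h) :
    KaramataTest lam r A (fun x => g x + h x) where
  summable t ht := by simpa only [mul_add] using (hg.summable t ht).add (hh.summable t ht)
  integrable := by
    simp only [mul_add]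
    exact hg.integrable.add hh.integrable
  tendsto := by
    simp only [mul_add]
    rw [integral_add hg.integrable hh.integrable, mul_add]
    refine (hg.tendsto.add hh.tendsto).congr' ?_
    filter_upwards [self_mem_nhdsWithin] with t ht
    rw [(hg.summable t ht).tsum_add (hh.summable t ht), mul_add]

theorem monomial {a : ℝ} (hr : 0 < r)
    (hsum : ∀ t : ℝ, 0 < t → Summable fun n => Real.exp (-(lam n * t)))
    (h : Tendsto (fun t : ℝ => t ^ r * ∑' n : ℕ, Real.exp (-(lam n * t))) (𝓝[>] 0) (𝓝 a))
    (k : ℕ) (c : ℝ) :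
    KaramataTest lam r (a / Real.Gamma r) (fun x => c * x ^ k) := by
  have hk : (0 : ℝ) < k + 1 := by positivity
  have hexp : ∀ y : ℝ, Real.exp (-y) * (c * Real.exp (-y) ^ k)
      = c * Real.exp (-((k + 1) * y)) := by
    intro y
    rw [← Real.exp_nat_mul, mul_left_comm, ← Real.exp_add]
    ring_nf
  have hterm : ∀ t : ℝ, ∀ n, Real.exp (-(lam n * t)) * (c * Real.exp (-(lam n * t)) ^ k)
      = c * Real.exp (-(lam n * ((k + 1) * t))) := by
    intro t n
    rw [hexp]
    ring_nf
  have hint : ∀ u : ℝ, Real.exp (-u) * u ^ (r - 1) * (c * Real.exp (-u) ^ k)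
      = c * (u ^ (r - 1) * Real.exp (-((k + 1) * u))) := by
    intro u
    rw [mul_right_comm, hexp]
    ring
  refine ⟨fun t ht => ?_, ?_, ?_⟩
  · simp only [hterm]
    exact (hsum _ (by positivity)).mul_left c
  · simp only [hint]
    refine Integrable.const_mul ?_ c
    have := integrableOn_rpow_mul_exp_neg_mul_rpow (p := 1) (s := r - 1) (b := (k : ℝ) + 1)
      (by linarith) one_pos hk
    simpa only [IntegrableOn, Real.rpow_one, neg_mul] using this
  · simp only [hint, hterm]
    rw [integral_const_mul, Real.integral_rpow_mul_exp_neg_mul_Ioi hr hk]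
    have hscale : Tendsto (fun t : ℝ => ((k : ℝ) + 1) * t) (𝓝[>] 0) (𝓝[>] 0) := by
      refine tendsto_nhdsWithin_iff.2 ⟨?_, ?_⟩
      · refine Tendsto.mono_left ?_ nhdsWithin_le_nhds
        exact Continuous.tendsto' (by fun_prop) _ _ (by simp)
      · filter_upwards [self_mem_nhdsWithin] with t ht
        exact mul_pos hk ht
    have hlim : a / Real.Gamma r * (c * ((1 / ((k : ℝ) + 1)) ^ r * Real.Gamma r))
        = c * (1 / ((k : ℝ) + 1)) ^ r * a := by
      have := (Real.Gamma_pos_of_pos hr).ne'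
      field_simp
    rw [hlim]
    refine ((h.comp hscale).const_mul (c * (1 / ((k : ℝ) + 1)) ^ r)).congr' ?_
    filter_upwards [self_mem_nhdsWithin] with t ht
    have ht' : (0 : ℝ) < t := ht
    simp only [Function.comp]
    rw [tsum_mul_left, Real.mul_rpow hk.le ht'.le, Real.div_rpow zero_le_one hk.le, Real.one_rpow]
    have : ((k : ℝ) + 1) ^ r ≠ 0 := (Real.rpow_pos_of_pos hk r).ne'
    generalize ∑' n : ℕ, Real.exp (-(lam n * ((k + 1) * t))) = S
    field_simp

theorem polynomial {a : ℝ} (hr : 0 < r)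
    (hsum : ∀ t : ℝ, 0 < t → Summable fun n => Real.exp (-(lam n * t)))
    (h : Tendsto (fun t : ℝ => t ^ r * ∑' n : ℕ, Real.exp (-(lam n * t))) (𝓝[>] 0) (𝓝 a))
    (p : Polynomial ℝ) :
    KaramataTest lam r (a / Real.Gamma r) (fun x => p.eval x) := by
  induction p using Polynomial.induction_on' with
  | add p q hp hq => simpa only [Polynomial.eval_add] using hp.add hq
  | monomial k c => simpa only [Polynomial.eval_monomial] using monomial hr hsum h k c

/-- A function squeezed between two uniformly bounded sequences of test functions, which both
converge to it on the unit interval outside one point, is a test function. -/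
theorem squeeze (hr : 0 < r) (hpos : ∀ n, 0 < lam n)
    (hsum : ∀ t : ℝ, 0 < t → Summable fun n => Real.exp (-(lam n * t)))
    {G : ℝ → ℝ} {g h : ℕ → ℝ → ℝ} (C c : ℝ)
    (hg : ∀ k, KaramataTest lam r A (g k)) (hh : ∀ k, KaramataTest lam r A (h k))
    (hgG : ∀ k, ∀ x ∈ Ioo (0 : ℝ) 1, g k x ≤ G x) (hGh : ∀ k, ∀ x ∈ Ioo (0 : ℝ) 1, G x ≤ h k x)
    (hgC : ∀ k, ∀ x ∈ Ioo (0 : ℝ) 1, |g k x| ≤ C) (hhC : ∀ k, ∀ x ∈ Ioo (0 : ℝ) 1, |h k x| ≤ C)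
    (hglim : ∀ x ∈ Ioo (0 : ℝ) 1, x ≠ c → Tendsto (fun k => g k x) atTop (𝓝 (G x)))
    (hhlim : ∀ x ∈ Ioo (0 : ℝ) 1, x ≠ c → Tendsto (fun k => h k x) atTop (𝓝 (G x))) :
    KaramataTest lam r A G := by
  have hmem : ∀ u : ℝ, 0 < u → Real.exp (-u) ∈ Ioo (0 : ℝ) 1 := fun u hu =>
    ⟨Real.exp_pos _, by simpa using hu⟩
  have hbound : IntegrableOn (fun u : ℝ => Real.exp (-u) * u ^ (r - 1) * C) (Ioi 0) :=
    (Real.GammaIntegral_convergent hr).mul_const C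
  have hne : ∀ᵐ u ∂(volume.restrict (Ioi (0 : ℝ))), u ≠ -Real.log c :=
    ae_restrict_of_ae (Measure.ae_ne volume _)
  have hae : ∀ f : ℕ → ℝ → ℝ,
      (∀ x ∈ Ioo (0 : ℝ) 1, x ≠ c → Tendsto (fun k => f k x) atTop (𝓝 (G x))) →
      ∀ᵐ u ∂(volume.restrict (Ioi (0 : ℝ))),
        Tendsto (fun k => Real.exp (-u) * u ^ (r - 1) * f k (Real.exp (-u))) atTop
          (𝓝 (Real.exp (-u) * u ^ (r - 1) * G (Real.exp (-u)))) := by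
    intro f hf
    filter_upwards [hne, ae_restrict_mem measurableSet_Ioi] with u hu hu0
    refine (hf _ (hmem u hu0) ?_).const_mul _
    rintro rfl
    simp at hu
  have hdom : ∀ f : ℝ → ℝ, (∀ x ∈ Ioo (0 : ℝ) 1, |f x| ≤ C) →
      ∀ᵐ u ∂(volume.restrict (Ioi (0 : ℝ))),
        ‖Real.exp (-u) * u ^ (r - 1) * f (Real.exp (-u))‖ ≤ Real.exp (-u) * u ^ (r - 1) * C := by
    intro f hf
    filter_upwards [ae_restrict_mem measurableSet_Ioi] with u hu
    have hw : 0 ≤ Real.exp (-u) * u ^ (r - 1) :=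
      mul_nonneg (Real.exp_pos _).le (Real.rpow_nonneg (le_of_lt hu) _)
    rw [norm_mul, Real.norm_of_nonneg hw, Real.norm_eq_abs]
    exact mul_le_mul_of_nonneg_left (hf _ (hmem u hu)) hw
  have hconv : ∀ f : ℕ → ℝ → ℝ, (∀ k, KaramataTest lam r A (f k)) →
      (∀ k, ∀ x ∈ Ioo (0 : ℝ) 1, |f k x| ≤ C) →
      (∀ x ∈ Ioo (0 : ℝ) 1, x ≠ c → Tendsto (fun k => f k x) atTop (𝓝 (G x))) →
      Tendsto (fun k => A * ∫ u in Ioi (0 : ℝ), Real.exp (-u) * u ^ (r - 1) * f k (Real.exp (-u)))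
        atTop (𝓝 (A * ∫ u in Ioi (0 : ℝ), Real.exp (-u) * u ^ (r - 1) * G (Real.exp (-u)))) := by
    intro f hf hfC hflim
    exact (tendsto_integral_of_dominated_convergence _
      (fun k => (hf k).integrable.aestronglyMeasurable) hbound (fun k => hdom _ (hfC k))
      (hae f hflim)).const_mul A
  have hGC : ∀ x ∈ Ioo (0 : ℝ) 1, |G x| ≤ C := fun x hx =>
    abs_le.2 ⟨(abs_le.1 (hgC 0 x hx)).1.trans (hgG 0 x hx),
      (hGh 0 x hx).trans (abs_le.1 (hhC 0 x hx)).2⟩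
  have hGsum : ∀ t : ℝ, 0 < t →
      Summable fun n => Real.exp (-(lam n * t)) * G (Real.exp (-(lam n * t))) := by
    intro t ht
    refine Summable.of_norm_bounded ((hsum t ht).mul_right C) fun n => ?_
    rw [norm_mul, Real.norm_of_nonneg (Real.exp_pos _).le, Real.norm_eq_abs]
    exact mul_le_mul_of_nonneg_left (hGC _ (hmem _ (mul_pos (hpos n) ht))) (Real.exp_pos _).le
  refine ⟨hGsum, ?_, tendsto_order.2 ⟨fun b hb => ?_, fun b hb => ?_⟩⟩
  · exact hbound.mono' (aestronglyMeasurable_of_tendsto_ae atTop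
      (fun k => (hg k).integrable.aestronglyMeasurable) (hae g hglim)) (hdom G hGC)
  · obtain ⟨k, hk⟩ := ((tendsto_order.1 (hconv g hg hgC hglim)).1 b hb).exists
    filter_upwards [(tendsto_order.1 (hg k).tendsto).1 b hk, self_mem_nhdsWithin] with t hb' ht
    refine hb'.trans_le (mul_le_mul_of_nonneg_left ?_ (Real.rpow_nonneg (le_of_lt ht) _))
    exact ((hg k).summable t ht).tsum_le_tsum (fun n => mul_le_mul_of_nonneg_left
      (hgG k _ (hmem _ (mul_pos (hpos n) ht))) (Real.exp_pos _).le) (hGsum t ht)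
  · obtain ⟨k, hk⟩ := ((tendsto_order.1 (hconv h hh hhC hhlim)).2 b hb).exists
    filter_upwards [(tendsto_order.1 (hh k).tendsto).2 b hk, self_mem_nhdsWithin] with t hb' ht
    refine (mul_le_mul_of_nonneg_left ?_ (Real.rpow_nonneg (le_of_lt ht) _)).trans_lt hb'
    exact (hGsum t ht).tsum_le_tsum (fun n => mul_le_mul_of_nonneg_left
      (hGh k _ (hmem _ (mul_pos (hpos n) ht))) (Real.exp_pos _).le) ((hh k).summable t ht)

theorem continuous {a : ℝ} (hr : 0 < r) (hpos : ∀ n, 0 < lam n)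
    (hsum : ∀ t : ℝ, 0 < t → Summable fun n => Real.exp (-(lam n * t)))
    (h : Tendsto (fun t : ℝ => t ^ r * ∑' n : ℕ, Real.exp (-(lam n * t))) (𝓝[>] 0) (𝓝 a))
    {G : ℝ → ℝ} (hG : Continuous G) :
    KaramataTest lam r (a / Real.Gamma r) G := by
  have hε : ∀ k : ℕ, (0 : ℝ) < 1 / ((k : ℝ) + 1) := fun k => Nat.one_div_pos_of_nat
  have hε1 : ∀ k : ℕ, 1 / ((k : ℝ) + 1) ≤ 1 := fun k => by
    rw [div_le_one (by positivity)]
    linarith [k.cast_nonneg (α := ℝ)]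
  choose p hp using fun k : ℕ =>
    exists_polynomial_near_of_continuousOn 0 1 G hG.continuousOn _ (hε k)
  obtain ⟨M, hM⟩ := isCompact_Icc.exists_bound_of_continuousOn (hG.continuousOn (s := Icc 0 1))
  have hlim : Tendsto (fun k : ℕ => 2 * (1 / ((k : ℝ) + 1))) atTop (𝓝 0) := by
    simpa using (tendsto_one_div_add_atTop_nhds_zero_nat (𝕜 := ℝ)).const_mul 2
  have key : ∀ k : ℕ, ∀ x ∈ Ioo (0 : ℝ) 1, |(p k).eval x - G x| < 1 / ((k : ℝ) + 1) ∧ |G x| ≤ M :=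
    fun k x hx => ⟨hp k x (Ioo_subset_Icc_self hx), hM x (Ioo_subset_Icc_self hx)⟩
  refine squeeze hr hpos hsum (M + 2) 0
    (g := fun k x => (p k - Polynomial.C (1 / ((k : ℝ) + 1))).eval x)
    (h := fun k x => (p k + Polynomial.C (1 / ((k : ℝ) + 1))).eval x)
    (fun k => polynomial hr hsum h _) (fun k => polynomial hr hsum h _) ?_ ?_ ?_ ?_ ?_ ?_
  all_goals simp only [Polynomial.eval_sub, Polynomial.eval_add, Polynomial.eval_C]
  · intro k x hx
    linarith [abs_lt.1 (key k x hx).1]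
  · intro k x hx
    linarith [abs_lt.1 (key k x hx).1]
  · intro k x hx
    have h₁ := abs_lt.1 (key k x hx).1
    have h₂ := abs_le.1 (key k x hx).2
    exact abs_le.2 ⟨by linarith [hε1 k], by linarith [hε1 k]⟩
  · intro k x hx
    have h₁ := abs_lt.1 (key k x hx).1
    have h₂ := abs_le.1 (key k x hx).2
    exact abs_le.2 ⟨by linarith [hε1 k], by linarith [hε1 k]⟩
  · intro x hx _
    refine tendsto_iff_dist_tendsto_zero.2 (squeeze_zero (fun _ => dist_nonneg) (fun k => ?_) hlim)
    have h₁ := abs_lt.1 (key k x hx).1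
    exact abs_le.2 ⟨by linarith, by linarith⟩
  · intro x hx _
    refine tendsto_iff_dist_tendsto_zero.2 (squeeze_zero (fun _ => dist_nonneg) (fun k => ?_) hlim)
    have h₁ := abs_lt.1 (key k x hx).1
    exact abs_le.2 ⟨by linarith, by linarith⟩

theorem cutoff {a : ℝ} (hr : 0 < r) (hpos : ∀ n, 0 < lam n)
    (hsum : ∀ t : ℝ, 0 < t → Summable fun n => Real.exp (-(lam n * t)))
    (h : Tendsto (fun t : ℝ => t ^ r * ∑' n : ℕ, Real.exp (-(lam n * t))) (𝓝[>] 0) (𝓝 a))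
    {c : ℝ} (hc : 0 < c) :
    KaramataTest lam r (a / Real.Gamma r) (fun x => (if c ≤ x then 1 else 0) / max x c) := by
  have hmax : ∀ x : ℝ, 0 < max x c := fun x => lt_max_of_lt_right hc
  have hcont : ∀ s k : ℝ, Continuous fun x : ℝ => max 0 (min 1 (s + k * (x - c))) / max x c :=
    fun s k => Continuous.div (by fun_prop) (by fun_prop) fun x => (hmax x).ne'
  have hbd : ∀ s k x : ℝ, |max 0 (min 1 (s + k * (x - c))) / max x c| ≤ 1 / c := by
    intro s k x
    have h₀ : (0 : ℝ) ≤ max 0 (min 1 (s + k * (x - c))) := le_max_left _ _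
    rw [abs_of_nonneg (div_nonneg h₀ (hmax x).le)]
    exact div_le_div₀ zero_le_one (max_le zero_le_one (min_le_left _ _)) hc (le_max_right _ _)
  have hlim : ∀ s x : ℝ, x ≠ c → Tendsto
      (fun k : ℕ => max 0 (min 1 (s + (k : ℝ) * (x - c))) / max x c) atTop
      (𝓝 ((if c ≤ x then 1 else 0) / max x c)) := by
    intro s x hx
    refine Tendsto.div_const ?_ _
    rcases hx.lt_or_gt with hlt | hgt
    · rw [if_neg hlt.not_ge]
      have : Tendsto (fun k : ℕ => s + (k : ℝ) * (x - c)) atTop atBot :=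
        tendsto_atBot_add_const_left _ _
          (tendsto_natCast_atTop_atTop.atTop_mul_const_of_neg (sub_neg.2 hlt))
      refine tendsto_const_nhds.congr' ?_
      filter_upwards [this.eventually_le_atBot 0] with k hk
      exact (max_eq_left ((min_le_right _ _).trans hk)).symm
    · rw [if_pos hgt.le]
      have : Tendsto (fun k : ℕ => s + (k : ℝ) * (x - c)) atTop atTop :=
        tendsto_atTop_add_const_left _ _
          (tendsto_natCast_atTop_atTop.atTop_mul_const (sub_pos.2 hgt))
      refine tendsto_const_nhds.congr' ?_
      filter_upwards [this.eventually_ge_atTop 1] with k hk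
      rw [min_eq_left hk, max_eq_right zero_le_one]
  refine squeeze hr hpos hsum (1 / c) c
    (g := fun k x => max 0 (min 1 (0 + (k : ℝ) * (x - c))) / max x c)
    (h := fun k x => max 0 (min 1 (1 + (k : ℝ) * (x - c))) / max x c)
    (fun k => continuous hr hpos hsum h (hcont 0 k))
    (fun k => continuous hr hpos hsum h (hcont 1 k)) ?_ ?_
    (fun k x _ => hbd 0 k x) (fun k x _ => hbd 1 k x)
    (fun x _ hx => hlim 0 x hx) (fun x _ hx => hlim 1 x hx)
  · intro k x _
    refine div_le_div_of_nonneg_right ?_ (hmax x).le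
    split_ifs with hx
    · exact max_le zero_le_one (min_le_left _ _)
    · refine max_le le_rfl ((min_le_right _ _).trans ?_)
      have := mul_nonneg k.cast_nonneg (sub_nonneg.2 (not_le.1 hx).le)
      linarith
  · intro k x _
    refine div_le_div_of_nonneg_right ?_ (hmax x).le
    split_ifs with hx
    · refine le_max_of_le_right (le_min le_rfl ?_)
      have := mul_nonneg k.cast_nonneg (sub_nonneg.2 hx)
      linarith
    · exact le_max_left _ _

end KaramataTest

theorem finite_setOf_le_of_summable_exp {lam : ℕ → ℝ}
    (hsum : ∀ t : ℝ, 0 < t → Summable fun n => Real.exp (-(lam n * t))) (x : ℝ) :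
    {n : ℕ | lam n ≤ x}.Finite := by
  have h := (hsum 1 one_pos).tendsto_cofinite_zero.eventually_lt_const (Real.exp_pos (-x))
  refine (eventually_cofinite.1 h).subset fun n hn => ?_
  simpa using hn

theorem tsum_ite_le_eq_ncard_mul {lam : ℕ → ℝ} {x : ℝ} (hfin : {n : ℕ | lam n ≤ x}.Finite)
    (b : ℝ) : ∑' n, (if lam n ≤ x then b else 0) = (Set.ncard {n : ℕ | lam n ≤ x} : ℝ) * b := by
  rw [tsum_eq_sum (s := hfin.toFinset) (fun n hn => if_neg (by simpa using hn)),
    Set.ncard_eq_toFinset_card _ hfin, ← nsmul_eq_mul]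
  exact Finset.sum_eq_card_nsmul fun n hn => if_pos (by simpa using hn)

theorem tendsto_counting_of_tendsto_heatTrace {lam : ℕ → ℝ} (hpos : ∀ n, 0 < lam n)
    (hsum : ∀ t : ℝ, 0 < t → Summable fun n => Real.exp (-(lam n * t)))
    {r : ℝ} (hr : 0 < r) {a : ℝ}
    (h : Tendsto (fun t : ℝ => t ^ r * ∑' n : ℕ, Real.exp (-(lam n * t))) (𝓝[>] 0) (𝓝 a)) :
    Tendsto (fun x : ℝ => x ^ (-r) * (Set.ncard {n : ℕ | lam n ≤ x} : ℝ)) atTop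
      (𝓝 (a / Real.Gamma (r + 1))) := by
  have key := (KaramataTest.cutoff hr hpos hsum h (Real.exp_pos (-1))).tendsto
  have hval : ∀ y : ℝ, Real.exp (-y) * ((if Real.exp (-1) ≤ Real.exp (-y) then 1 else 0) /
      max (Real.exp (-y)) (Real.exp (-1))) = if y ≤ 1 then 1 else 0 := by
    intro y
    by_cases hy : y ≤ 1
    · have : Real.exp (-1) ≤ Real.exp (-y) := Real.exp_le_exp.2 (by linarith)
      rw [if_pos this, if_pos hy, max_eq_left this, mul_one_div_cancel (Real.exp_pos _).ne']
    · have : ¬ Real.exp (-1) ≤ Real.exp (-y) := fun h' => hy (by simpa using h')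
      rw [if_neg this, if_neg hy, zero_div, mul_zero]
  have hint : ∫ u in Ioi (0 : ℝ), Real.exp (-u) * u ^ (r - 1) *
      ((if Real.exp (-1) ≤ Real.exp (-u) then 1 else 0) /
        max (Real.exp (-u)) (Real.exp (-1))) = 1 / r := by
    calc _ = ∫ u in Ioi (0 : ℝ), (Iic (1 : ℝ)).indicator (fun u => u ^ (r - 1)) u := by
            refine setIntegral_congr_fun measurableSet_Ioi fun u _ => ?_
            simp only [mul_right_comm _ (u ^ (r - 1)), hval, indicator_apply, mem_Iic, ite_mul,
              one_mul, zero_mul]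
      _ = ∫ u in (0 : ℝ)..1, u ^ (r - 1) := by
            rw [setIntegral_indicator measurableSet_Iic, Ioi_inter_Iic,
              intervalIntegral.integral_of_le zero_le_one]
      _ = 1 / r := by
            rw [integral_rpow (Or.inl (by linarith))]
            simp [hr.ne']
  rw [hint] at key
  have hlim : a / Real.Gamma r * (1 / r) = a / Real.Gamma (r + 1) := by
    rw [Real.Gamma_add_one hr.ne', div_mul_div_comm, mul_one, mul_comm r]
  rw [hlim] at key
  refine (key.comp tendsto_inv_atTop_nhdsGT_zero).congr' ?_
  filter_upwards [eventually_gt_atTop 0] with x hx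
  simp only [Function.comp, hval]
  have hle : ∀ n, lam n * x⁻¹ ≤ 1 ↔ lam n ≤ x := fun n => by
    rw [← div_eq_mul_inv, div_le_one hx]
  simp only [hle]
  rw [tsum_ite_le_eq_ncard_mul (finite_setOf_le_of_summable_exp hsum x), mul_one,
    Real.inv_rpow hx.le, Real.rpow_neg hx.le]

theorem heatTrace_eq_integral_counting {lam : ℕ → ℝ} (hpos : ∀ n, 0 < lam n)
    (hsum : ∀ t : ℝ, 0 < t → Summable fun n => Real.exp (-(lam n * t))) {t : ℝ} (ht : 0 < t) :
    ∑' n : ℕ, Real.exp (-(lam n * t)) =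
      ∫ u in Ioi (0 : ℝ), (Set.ncard {n : ℕ | lam n ≤ u / t} : ℝ) * Real.exp (-u) := by
  have hexp : ∀ u : ℝ, (Set.ncard {n : ℕ | lam n ≤ u / t} : ℝ) * Real.exp (-u)
      = ∑' n, (Ici (lam n * t)).indicator (fun u => Real.exp (-u)) u := by
    intro u
    rw [← tsum_ite_le_eq_ncard_mul (finite_setOf_le_of_summable_exp hsum _)]
    simp only [indicator_apply, mem_Ici, le_div_iff₀ ht]
  have hI : ∀ n, ∫ u in Ioi (0 : ℝ), (Ici (lam n * t)).indicator (fun u => Real.exp (-u)) u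
      = Real.exp (-(lam n * t)) := by
    intro n
    have hsub : Ioi (0 : ℝ) ∩ Ici (lam n * t) = Ici (lam n * t) :=
      inter_eq_right.2 fun u hu => (mul_pos (hpos n) ht).trans_le hu
    rw [setIntegral_indicator measurableSet_Ici, hsub, integral_Ici_eq_integral_Ioi,
      integral_exp_neg_Ioi]
  simp only [hexp]
  rw [← integral_tsum_of_summable_integral_norm]
  · simp only [hI]
  · intro n
    exact (integrableOn_exp_neg_Ioi 0).indicator measurableSet_Ici
  · refine (hsum t ht).congr fun n => ?_
    rw [← hI n]
    refine integral_congr_ae (Eventually.of_forall fun u => ?_)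
    exact (Real.norm_of_nonneg (indicator_nonneg (fun _ _ => (Real.exp_pos _).le) u)).symm

theorem tendsto_heatTrace_of_tendsto_counting {lam : ℕ → ℝ} (hpos : ∀ n, 0 < lam n)
    (hsum : ∀ t : ℝ, 0 < t → Summable fun n => Real.exp (-(lam n * t)))
    {r : ℝ} (hr : 0 < r) {b : ℝ}
    (h : Tendsto (fun x : ℝ => x ^ (-r) * (Set.ncard {n : ℕ | lam n ≤ x} : ℝ)) atTop (𝓝 b)) :
    Tendsto (fun t : ℝ => t ^ r * ∑' n : ℕ, Real.exp (-(lam n * t))) (𝓝[>] 0)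
      (𝓝 (b * Real.Gamma (r + 1))) := by
  set N : ℝ → ℝ := fun x => (Set.ncard {n : ℕ | lam n ≤ x} : ℝ)
  have hN0 : ∀ x, 0 ≤ N x := fun x => Nat.cast_nonneg _
  have hmono : Monotone N := fun x y hxy => Nat.cast_le.2
    (ncard_le_ncard (fun n hn => le_trans hn hxy) (finite_setOf_le_of_summable_exp hsum y))
  obtain ⟨X, hX0, hX⟩ : ∃ X : ℝ, 0 < X ∧ ∀ x, X ≤ x → N x ≤ (b + 1) * x ^ r := by
    obtain ⟨X, hX⟩ := eventually_atTop.1 ((h.eventually_lt_const (lt_add_one b)).and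
      (eventually_gt_atTop 0))
    refine ⟨X, (hX X le_rfl).2, fun x hx => ?_⟩
    have hx' := hX x hx
    have hlt := hx'.1
    rw [Real.rpow_neg hx'.2.le, inv_mul_eq_div, div_lt_iff₀ (Real.rpow_pos_of_pos hx'.2 r)] at hlt
    exact hlt.le
  have hb : 0 ≤ b + 1 :=
    nonneg_of_mul_nonneg_left ((hN0 X).trans (hX X le_rfl)) (Real.rpow_pos_of_pos hX0 r)
  have hbound : ∀ x, 0 < x → N x ≤ N X + (b + 1) * x ^ r := by
    intro x hx
    rcases le_total x X with hxX | hXx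
    · have := mul_nonneg hb (Real.rpow_nonneg hx.le r)
      linarith [hmono hxX]
    · linarith [hX x hXx, hN0 X]
  have hGamma : ∫ u in Ioi (0 : ℝ), b * (Real.exp (-u) * u ^ r) = b * Real.Gamma (r + 1) := by
    rw [integral_const_mul, Real.Gamma_eq_integral (by linarith), add_sub_cancel_right]
  have hGint : IntegrableOn (fun u : ℝ => Real.exp (-u) * u ^ r) (Ioi 0) := by
    simpa using Real.GammaIntegral_convergent (s := r + 1) (by linarith)
  rw [← hGamma]
  have hconv : Tendsto (fun t : ℝ => ∫ u in Ioi (0 : ℝ), t ^ r * (N (u / t) * Real.exp (-u)))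
      (𝓝[>] 0) (𝓝 (∫ u in Ioi (0 : ℝ), b * (Real.exp (-u) * u ^ r))) := by
    refine tendsto_integral_filter_of_dominated_convergence
      (fun u => N X * Real.exp (-u) + (b + 1) * (Real.exp (-u) * u ^ r)) ?_ ?_ ?_ ?_
    · filter_upwards with t
      refine Measurable.aestronglyMeasurable ?_
      have := hmono.measurable
      fun_prop
    · filter_upwards [Ioo_mem_nhdsGT (zero_lt_one (α := ℝ))] with t ht
      filter_upwards [ae_restrict_mem measurableSet_Ioi] with u hu
      have hu' : (0 : ℝ) < u := hu
      have htr : 0 < t ^ r := Real.rpow_pos_of_pos ht.1 r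
      have htr1 : t ^ r ≤ 1 := Real.rpow_le_one ht.1.le ht.2.le hr.le
      rw [Real.norm_of_nonneg (mul_nonneg htr.le (mul_nonneg (hN0 _) (Real.exp_pos _).le))]
      have h₁ : t ^ r * N (u / t) ≤ N X + (b + 1) * u ^ r := by
        calc t ^ r * N (u / t) ≤ t ^ r * (N X + (b + 1) * (u / t) ^ r) :=
              mul_le_mul_of_nonneg_left (hbound _ (div_pos hu' ht.1)) htr.le
          _ = t ^ r * N X + (b + 1) * u ^ r := by
              rw [Real.div_rpow hu'.le ht.1.le]
              field_simp
          _ ≤ N X + (b + 1) * u ^ r := by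
              linarith [mul_le_of_le_one_left (hN0 X) htr1]
      calc t ^ r * (N (u / t) * Real.exp (-u)) = t ^ r * N (u / t) * Real.exp (-u) := by ring
        _ ≤ (N X + (b + 1) * u ^ r) * Real.exp (-u) :=
            mul_le_mul_of_nonneg_right h₁ (Real.exp_pos _).le
        _ = _ := by ring
    · exact ((integrableOn_exp_neg_Ioi 0).const_mul _).add (hGint.const_mul _)
    · filter_upwards [ae_restrict_mem measurableSet_Ioi] with u hu
      have hu' : (0 : ℝ) < u := hu
      have hdiv : Tendsto (fun t : ℝ => u / t) (𝓝[>] 0) atTop := by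
        simpa only [div_eq_mul_inv] using tendsto_inv_nhdsGT_zero.const_mul_atTop hu'
      refine ((h.comp hdiv).mul_const (Real.exp (-u) * u ^ r)).congr' ?_
      filter_upwards [self_mem_nhdsWithin] with t ht
      have ht' : (0 : ℝ) < t := ht
      have htr : t ^ r ≠ 0 := (Real.rpow_pos_of_pos ht' r).ne'
      have hur : u ^ r ≠ 0 := (Real.rpow_pos_of_pos hu' r).ne'
      change (u / t) ^ (-r) * N (u / t) * (Real.exp (-u) * u ^ r) = _
      rw [Real.rpow_neg (div_pos hu' ht').le, Real.div_rpow hu'.le ht'.le]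
      field_simp
  refine hconv.congr' ?_
  filter_upwards [self_mem_nhdsWithin] with t ht
  rw [integral_const_mul, heatTrace_eq_integral_counting hpos hsum ht]

/-- Karamata's Tauberian theorem: for a sequence `(λ_n)` of positive reals
whose heat trace `∑ e^{−λ_n t}` converges for every `t > 0`, and for `r > 0`,
`a ∈ ℝ`, one has `t^r ∑ e^{−λ_n t} → a` as `t → 0⁺` if and only if
`λ^{−r} N(λ) → a / Γ(r+1)` as `λ → ∞`, where `N(λ) = #{n : λ_n ≤ λ}`. -/
theorem karamata_tauberian
    (lam : ℕ → ℝ) (hpos : ∀ n, 0 < lam n)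
    (hsum : ∀ t : ℝ, 0 < t → Summable fun n => Real.exp (-(lam n * t)))
    (r : ℝ) (hr : 0 < r) (a : ℝ) :
    Filter.Tendsto (fun t : ℝ => t ^ r * ∑' n : ℕ, Real.exp (-(lam n * t)))
        (nhdsWithin 0 (Set.Ioi 0)) (nhds a) ↔
      Filter.Tendsto
        (fun x : ℝ => x ^ (-r) * (Set.ncard {n : ℕ | lam n ≤ x} : ℝ))
        Filter.atTop (nhds (a / Real.Gamma (r + 1))) := by
  refine ⟨tendsto_counting_of_tendsto_heatTrace hpos hsum hr, fun h => ?_⟩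
  have hΓ : Real.Gamma (r + 1) ≠ 0 := (Real.Gamma_pos_of_pos (by linarith)).ne'
  simpa only [div_mul_cancel₀ a hΓ] using tendsto_heatTrace_of_tendsto_counting hpos hsum hr h
end

section
/- Let n > 0 and W > 0 be real numbers and (μ_k)_{k≥1} a nondecreasing sequence of positive real numbers tending to infinity whose counting function satisfies N(λ)/λ^{n/2} → W as λ → ∞. Then for every ρ > 0, R_ρ(z)/z^{ρ + n/2} → (Γ(ρ+1) Γ(1 + n/2) / Γ(ρ + 1 + n/2)) · W as z → ∞. -/
open MeasureTheory Set Filter Topology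

/-- The Beta integral over the reals in terms of the Gamma function. -/
lemma setIntegral_rpow_mul_one_sub_rpow {α β : ℝ} (hα : 0 < α) (hβ : 0 < β) :
    ∫ x in Ioc (0 : ℝ) 1, x ^ (α - 1) * (1 - x) ^ (β - 1) =
      Real.Gamma α * Real.Gamma β / Real.Gamma (α + β) := by
  have h := ProbabilityTheory.beta_eq_betaIntegralReal α β hα hβ
  rw [ProbabilityTheory.beta] at h
  rw [h, Complex.betaIntegral, intervalIntegral.integral_of_le zero_le_one,
    ← RCLike.re_to_complex, ← integral_re]
  · refine setIntegral_congr_fun measurableSet_Ioc fun x ⟨hx1, hx₂⟩ ↦ ?_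
    norm_cast
    rw [← Complex.ofReal_cpow hx1.le, ← Complex.ofReal_cpow (by linarith), RCLike.re_to_complex,
      Complex.re_mul_ofReal, Complex.ofReal_re]
  · exact (intervalIntegrable_iff_integrableOn_Ioc_of_le zero_le_one).1
      (Complex.betaIntegral_convergent (u := α) (v := β) (by simpa) (by simpa))

lemma integrableOn_one_sub_rpow {ρ : ℝ} (hρ : 0 < ρ) :
    IntegrableOn (fun s : ℝ ↦ ρ * (1 - s) ^ (ρ - 1)) (Ioc 0 1) := by
  rw [← intervalIntegrable_iff_integrableOn_Ioc_of_le zero_le_one]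
  have h : IntervalIntegrable (fun s : ℝ ↦ s ^ (ρ - 1)) volume 0 1 :=
    intervalIntegral.intervalIntegrable_rpow' (by linarith)
  have h' := (h.comp_sub_left 1).symm
  simp only [sub_zero, sub_self] at h'
  exact h'.const_mul ρ

lemma setIntegral_indicator_one_sub_rpow {ρ a : ℝ} (hρ : 0 < ρ) (ha : 0 < a) :
    ∫ s in Ioc (0 : ℝ) 1, (Ici a).indicator (fun s ↦ ρ * (1 - s) ^ (ρ - 1)) s =
      (max (1 - a) 0) ^ ρ := by
  have hset : Ioc (0 : ℝ) 1 ∩ Ici a = Icc a 1 := by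
    ext x
    simp only [mem_inter_iff, mem_Ioc, mem_Ici, mem_Icc]
    exact ⟨fun h ↦ ⟨h.2, h.1.2⟩, fun h ↦ ⟨⟨ha.trans_le h.1, h.2⟩, h.1⟩⟩
  rw [setIntegral_indicator measurableSet_Ici, hset]
  rcases le_or_gt a 1 with h | h
  · rw [integral_Icc_eq_integral_Ioc, ← intervalIntegral.integral_of_le h,
      intervalIntegral.integral_const_mul,
      intervalIntegral.integral_comp_sub_left (fun s ↦ s ^ (ρ - 1)) 1,
      integral_rpow (Or.inl (by linarith)), max_eq_left (by linarith), sub_self,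
      sub_add_cancel, Real.zero_rpow hρ.ne']
    field_simp
    simp
  · rw [Icc_eq_empty (not_le.2 h), max_eq_right (by linarith), Real.zero_rpow hρ.ne']
    simp

lemma finite_setOf_le {μ : ℕ → ℝ} (htend : Tendsto μ atTop atTop) (z : ℝ) :
    {k : ℕ | μ k ≤ z}.Finite := by
  have h := htend.eventually_gt_atTop z
  rw [← Nat.cofinite_eq_atTop, eventually_cofinite] at h
  simpa using h

/-- The Riesz mean as a weighted integral of the counting function. -/
lemma rieszMean_eq_integral {μ : ℕ → ℝ} (hpos : ∀ k, 0 < μ k)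
    (htend : Tendsto μ atTop atTop) {ρ z : ℝ} (hρ : 0 < ρ) (hz : 0 < z) :
    rieszMean μ ρ z = z ^ ρ * ∫ s in Ioc (0 : ℝ) 1,
      ρ * (1 - s) ^ (ρ - 1) * (ncard {k : ℕ | μ k ≤ s * z} : ℝ) := by
  have hfin := finite_setOf_le htend z
  have hterm (k : ℕ) : (max (z - μ k) 0) ^ ρ = z ^ ρ *
      ∫ s in Ioc (0 : ℝ) 1, (Ici (μ k / z)).indicator (fun s ↦ ρ * (1 - s) ^ (ρ - 1)) s := by
    rw [setIntegral_indicator_one_sub_rpow hρ (div_pos (hpos k) hz),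
      ← Real.mul_rpow hz.le (le_max_right _ _), mul_max_of_nonneg _ _ hz.le]
    congr 2
    · field_simp
    · simp
  have hzero (k : ℕ) (hk : k ∉ hfin.toFinset) : (max (z - μ k) 0) ^ ρ = 0 := by
    have : z < μ k := by simpa using hk
    rw [max_eq_right (by linarith), Real.zero_rpow hρ.ne']
  rw [rieszMean, tsum_eq_sum hzero, Finset.sum_congr rfl fun k _ ↦ hterm k, ← Finset.mul_sum,
    ← integral_finsetSum _ fun k _ ↦ (integrableOn_one_sub_rpow hρ).indicator measurableSet_Ici]
  congr 1
  refine setIntegral_congr_fun measurableSet_Ioc fun s hs ↦ ?_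
  have hset : {k : ℕ | μ k ≤ s * z} = ↑(hfin.toFinset.filter fun k ↦ μ k / z ≤ s) := by
    ext k
    simp only [mem_ofPred_eq, Finset.coe_filter, Finite.mem_toFinset, div_le_iff₀ hz]
    exact ⟨fun h ↦ ⟨h.trans (mul_le_of_le_one_left hz.le hs.2), h⟩, And.right⟩
  simp only [hset, ncard_coe_finset, indicator_apply, mem_Ici, ← Finset.sum_filter,
    Finset.sum_const, nsmul_eq_mul]
  exact mul_comm _ _

/-- If the counting function `N(λ) = #{k : μ_k ≤ λ}` satisfies
`N(λ)/λ^{n/2} → W` as `λ → ∞`, then for every `ρ > 0`,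
`R_ρ(z)/z^{ρ + n/2} → (Γ(ρ+1) Γ(1 + n/2)/Γ(ρ + 1 + n/2)) W` as `z → ∞`. -/
theorem riesz_mean_asymptotics
    (n W : ℝ) (hn : 0 < n) (hW : 0 < W) (μ : ℕ → ℝ)
    (hpos : ∀ k, 0 < μ k) (hmono : Monotone μ)
    (htend : Filter.Tendsto μ Filter.atTop Filter.atTop)
    (hN : Filter.Tendsto
      (fun lam : ℝ => (Set.ncard {k : ℕ | μ k ≤ lam} : ℝ) / lam ^ (n / 2))
      Filter.atTop (nhds W)) :
    ∀ ρ : ℝ, 0 < ρ →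
      Filter.Tendsto (fun z : ℝ => rieszMean μ ρ z / z ^ (ρ + n / 2))
        Filter.atTop
        (nhds (Real.Gamma (ρ + 1) * Real.Gamma (1 + n / 2) /
          Real.Gamma (ρ + 1 + n / 2) * W)) := by
  intro ρ hρ
  set N : ℝ → ℝ := fun lam ↦ (ncard {k : ℕ | μ k ≤ lam} : ℝ) with hNdef
  have hNmono : Monotone N := fun x y hxy ↦ by
    simp only [hNdef, Nat.cast_le]
    exact ncard_le_ncard (fun k hk ↦ le_trans hk hxy) (finite_setOf_le htend y)
  have hlim : Tendsto (fun z : ℝ ↦ ∫ s in Ioc (0 : ℝ) 1,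
      ρ * (1 - s) ^ (ρ - 1) * (N (s * z) / z ^ (n / 2))) atTop
      (𝓝 (∫ s in Ioc (0 : ℝ) 1, ρ * (1 - s) ^ (ρ - 1) * (W * s ^ (n / 2)))) := by
    refine tendsto_integral_filter_of_dominated_convergence
      (fun s ↦ ρ * (1 - s) ^ (ρ - 1) * (W + 1)) ?_ ?_
      ((integrableOn_one_sub_rpow hρ).mul_const _) ?_
    · filter_upwards [eventually_gt_atTop 0] with z hz
      have : Measurable fun s ↦ N (s * z) :=
        hNmono.measurable.comp (measurable_id.mul_const z)
      exact Measurable.aestronglyMeasurable (by fun_prop)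
    · filter_upwards [eventually_gt_atTop 0, hN.eventually_le_const (lt_add_one W)] with z hz hzN
      refine ae_restrict_of_forall_mem measurableSet_Ioc fun s hs ↦ ?_
      have hw : 0 ≤ ρ * (1 - s) ^ (ρ - 1) :=
        mul_nonneg hρ.le (Real.rpow_nonneg (by linarith [hs.2]) _)
      have hq : 0 ≤ N (s * z) / z ^ (n / 2) := by positivity
      rw [Real.norm_of_nonneg (mul_nonneg hw hq)]
      refine mul_le_mul_of_nonneg_left (le_trans ?_ hzN) hw
      exact div_le_div_of_nonneg_right (hNmono (mul_le_of_le_one_left hz.le hs.2)) (by positivity)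
    · refine ae_restrict_of_forall_mem measurableSet_Ioc fun s hs ↦ Tendsto.const_mul _ ?_
      refine ((hN.comp (tendsto_id.const_mul_atTop hs.1)).mul_const (s ^ (n / 2))).congr' ?_
      filter_upwards [eventually_gt_atTop 0] with z hz
      have h1 := (Real.rpow_pos_of_pos hs.1 (n / 2)).ne'
      simp only [Function.comp_apply, id, hNdef, Real.mul_rpow hs.1.le hz.le]
      field_simp
  have hval : ∫ s in Ioc (0 : ℝ) 1, ρ * (1 - s) ^ (ρ - 1) * (W * s ^ (n / 2)) =
      Real.Gamma (ρ + 1) * Real.Gamma (1 + n / 2) / Real.Gamma (ρ + 1 + n / 2) * W := by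
    have h := setIntegral_rpow_mul_one_sub_rpow (α := 1 + n / 2) (β := ρ) (by positivity) hρ
    rw [add_sub_cancel_left] at h
    calc _ = ∫ s in Ioc (0 : ℝ) 1, ρ * W * (s ^ (n / 2) * (1 - s) ^ (ρ - 1)) := by
          congr 1; ext s; ring
      _ = _ := by
          rw [integral_const_mul, h, Real.Gamma_add_one hρ.ne',
            show 1 + n / 2 + ρ = ρ + 1 + n / 2 by ring]
          ring
  rw [← hval]
  refine hlim.congr' ?_
  filter_upwards [eventually_gt_atTop 0] with z hz
  rw [rieszMean_eq_integral hpos htend hρ hz, Real.rpow_add hz,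
    mul_div_mul_left _ _ (Real.rpow_pos_of_pos hz ρ).ne', ← integral_div]
  simp only [hNdef, mul_div_assoc]
end

section
/- Abstract Berezin–Li–Yau inequality: Let n > 0 and W > 0 be real numbers and (μ_k)_{k≥1} a nondecreasing sequence of positive real numbers tending to infinity such that (i) R_2(z) ≤ (4/n) ∑_{k≥1} (z − μ_k)_+ μ_k for every z ≥ 0, and (ii) the counting function satisfies N(λ)/λ^{n/2} → W as λ → ∞. Then for every real ρ ≥ 2 and every z > 0, R_ρ(z) ≤ (Γ(ρ+1) Γ(1 + n/2) / Γ(ρ + 1 + n/2)) · W · z^{ρ + n/2}. -/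
open MeasureTheory intervalIntegral Filter Topology

/-- The Beta integral over `[0, z]` in terms of the Gamma function. -/
lemma integral_rpow_mul_sub_rpow {u v z : ℝ} (hu : 0 < u) (hv : 0 < v) (hz : 0 < z) :
    ∫ x in (0 : ℝ)..z, x ^ (u - 1) * (z - x) ^ (v - 1) =
      Real.Gamma u * Real.Gamma v / Real.Gamma (u + v) * z ^ (u + v - 1) := by
  have h := Complex.betaIntegral_scaled (u : ℂ) (v : ℂ) hz
  rw [Complex.betaIntegral_eq_Gamma_mul_div _ _ (by simpa) (by simpa)] at h
  apply Complex.ofReal_injective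
  rw [← intervalIntegral.integral_ofReal]
  rw [← Complex.ofReal_add, Complex.Gamma_ofReal, Complex.Gamma_ofReal, Complex.Gamma_ofReal] at h
  push_cast [Complex.ofReal_cpow hz.le] at h ⊢
  rw [mul_comm _ ((z : ℂ) ^ _), ← h]
  refine intervalIntegral.integral_congr fun x hx => ?_
  rw [Set.uIcc_of_le hz.le] at hx
  rw [Complex.ofReal_cpow hx.1, Complex.ofReal_cpow (sub_nonneg.2 hx.2)]
  push_cast
  rfl

lemma intervalIntegrable_mul_sub_rpow {f : ℝ → ℝ} (hf : Continuous f) {v : ℝ} (hv : 0 < v)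
    (a b z : ℝ) :
    IntervalIntegrable (fun x => f x * (z - x) ^ (v - 1)) volume a b := by
  refine IntervalIntegrable.continuousOn_mul ?_ hf.continuousOn
  have h := (intervalIntegrable_rpow' (a := z - a) (b := z - b)
    (show -1 < v - 1 by linarith)).comp_sub_left z
  simpa using h

/-- Riesz iteration for a single truncated power. -/
lemma integral_max_rpow_mul_sub_rpow {u v m z : ℝ} (hu : 1 < u) (hv : 0 < v) (hm : 0 ≤ m)
    (hz : 0 ≤ z) :
    ∫ t in (0 : ℝ)..z, max (t - m) 0 ^ (u - 1) * (z - t) ^ (v - 1) =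
      Real.Gamma u * Real.Gamma v / Real.Gamma (u + v) * max (z - m) 0 ^ (u + v - 1) := by
  have vanish : ∀ b, 0 ≤ b → b ≤ m →
      ∫ t in (0 : ℝ)..b, max (t - m) 0 ^ (u - 1) * (z - t) ^ (v - 1) = 0 := by
    intro b hb hbm
    rw [intervalIntegral.integral_congr (g := fun _ => (0 : ℝ))]
    · simp
    · intro t ht
      rw [Set.uIcc_of_le hb] at ht
      simp only
      rw [max_eq_right (by linarith [ht.2]), Real.zero_rpow (by linarith), zero_mul]
  rcases le_or_gt z m with h | h
  · rw [vanish z hz h, max_eq_right (by linarith), Real.zero_rpow (by linarith), mul_zero]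
  · have hc : Continuous fun t : ℝ => max (t - m) 0 ^ (u - 1) :=
      ((continuous_id.sub continuous_const).max continuous_const).rpow_const
        fun _ => Or.inr (by linarith)
    rw [← integral_add_adjacent_intervals (b := m) (intervalIntegrable_mul_sub_rpow hc hv _ _ _)
      (intervalIntegrable_mul_sub_rpow hc hv _ _ _), vanish m hm le_rfl, zero_add,
      max_eq_left (by linarith),
      ← integral_rpow_mul_sub_rpow (by linarith) hv (sub_pos.2 h)]
    have e := intervalIntegral.integral_comp_sub_right (a := m) (b := z)
      (fun x => x ^ (u - 1) * (z - m - x) ^ (v - 1)) m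
    rw [sub_self] at e
    rw [← e]
    refine intervalIntegral.integral_congr fun t ht => ?_
    rw [Set.uIcc_of_le h.le] at ht
    rw [max_eq_left (by linarith [ht.1]), sub_sub_sub_cancel_right]

lemma intervalIntegrable_indicator_mul_sub (m z a b : ℝ) :
    IntervalIntegrable (fun t => (if m ≤ t then 1 else 0) * (2 * (z - t))) volume a b := by
  have h : Continuous fun t : ℝ => 2 * (z - t) := by fun_prop
  have e : (fun t => (if m ≤ t then 1 else 0) * (2 * (z - t))) =
      (Set.Ici m).indicator fun t => 2 * (z - t) := by
    ext t
    simp [Set.indicator_apply]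
  rw [e, intervalIntegrable_iff]
  exact (intervalIntegrable_iff.1 (h.intervalIntegrable a b)).indicator measurableSet_Ici

lemma max_sq_eq_integral {m z : ℝ} (hm : 0 ≤ m) (hz : 0 ≤ z) :
    max (z - m) 0 ^ (2 : ℝ) =
      ∫ t in (0 : ℝ)..z, (if m ≤ t then 1 else 0) * (2 * (z - t)) := by
  have vanish : ∀ b, 0 ≤ b → b ≤ m →
      ∫ t in (0 : ℝ)..b, (if m ≤ t then 1 else 0) * (2 * (z - t)) = 0 := by
    intro b hb hbm
    rw [intervalIntegral.integral_congr_Ioo_of_le (g := fun _ => (0 : ℝ)) hb]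
    · simp
    · intro t ht
      simp [not_le.2 (ht.2.trans_le hbm)]
  rcases le_or_gt z m with h | h
  · rw [vanish z hz h, max_eq_right (by linarith), Real.zero_rpow (by norm_num)]
  · rw [← integral_add_adjacent_intervals (b := m) (intervalIntegrable_indicator_mul_sub _ _ _ _)
      (intervalIntegrable_indicator_mul_sub _ _ _ _), vanish m hm le_rfl, zero_add,
      max_eq_left (by linarith)]
    rw [intervalIntegral.integral_congr (g := fun t => 2 * (z - t))]
    · have e := intervalIntegral.integral_comp_sub_left (a := m) (b := z)
        (fun x => 2 * x) z
      rw [e, intervalIntegral.integral_const_mul, integral_id, Real.rpow_two]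
      ring
    · intro t ht
      rw [Set.uIcc_of_le h.le] at ht
      simp [ht.1]

lemma hasDerivAt_max_sq (m t : ℝ) :
    HasDerivAt (fun t => max (t - m) 0 ^ (2 : ℝ)) (2 * max (t - m) 0) t := by
  rcases lt_trichotomy t m with h | h | h
  · rw [max_eq_right (by linarith), mul_zero]
    refine (hasDerivAt_const t (0 : ℝ)).congr_of_eventuallyEq ?_
    filter_upwards [Iio_mem_nhds h] with s hs
    rw [max_eq_right (by linarith [Set.mem_Iio.1 hs]), Real.zero_rpow (by norm_num)]
  · subst h
    rw [sub_self, max_self, mul_zero, hasDerivAt_iff_isLittleO]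
    have h1 : (fun s : ℝ => (s - t) ^ 2) =o[𝓝 t] fun s => s - t := by
      have h0 : (fun x : ℝ => x ^ 2) =o[𝓝 0] fun x => x := by
        simpa using Asymptotics.isLittleO_pow_id (𝕜 := ℝ) (n := 2) (by norm_num)
      exact h0.comp_tendsto (by simpa using (continuous_sub_right t).tendsto t)
    refine Asymptotics.IsBigO.trans_isLittleO (.of_norm_le fun s => ?_) h1
    rw [sub_self t, max_self, Real.zero_rpow two_ne_zero, smul_zero, sub_zero, sub_zero, Real.rpow_two, norm_pow,
      ← sq_abs (s - t)]
    refine pow_le_pow_left₀ (norm_nonneg _) ?_ 2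
    rw [Real.norm_of_nonneg (le_max_right _ _)]
    exact max_le (le_abs_self _) (abs_nonneg _)
  · rw [max_eq_left (by linarith)]
    have h1 : HasDerivAt (fun s : ℝ => (s - m) ^ 2) (2 * (t - m)) t := by
      simpa using ((hasDerivAt_id t).sub_const m).fun_pow 2
    refine h1.congr_of_eventuallyEq ?_
    filter_upwards [Ioi_mem_nhds h] with s hs
    rw [max_eq_left (by linarith [Set.mem_Ioi.1 hs]), Real.rpow_two]

/-- Only finitely many terms of a Riesz mean are nonzero, uniformly below a fixed level. -/
lemma exists_forall_lt_of_tendsto {μ : ℕ → ℝ} (htend : Tendsto μ atTop atTop) (Z : ℝ) :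
    ∃ K, ∀ k, k ∉ Finset.range K → Z < μ k := by
  obtain ⟨K, hK⟩ := eventually_atTop.1 (htend.eventually_gt_atTop Z)
  exact ⟨K, fun k hk => hK k (by simpa using hk)⟩

lemma rieszMean_eq_sum {μ : ℕ → ℝ} {Z : ℝ} {s : Finset ℕ} (hs : ∀ k, k ∉ s → Z < μ k)
    {ρ t : ℝ} (hρ : 0 < ρ) (ht : t ≤ Z) :
    rieszMean μ ρ t = ∑ k ∈ s, max (t - μ k) 0 ^ ρ := by
  refine tsum_eq_sum fun k hk => ?_
  rw [max_eq_right (by linarith [hs k hk]), Real.zero_rpow hρ.ne']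

lemma ncard_eq_sum {μ : ℕ → ℝ} {Z : ℝ} {s : Finset ℕ} (hs : ∀ k, k ∉ s → Z < μ k)
    {t : ℝ} (ht : t ≤ Z) :
    (Set.ncard {k : ℕ | μ k ≤ t} : ℝ) = ∑ k ∈ s, if μ k ≤ t then (1 : ℝ) else 0 := by
  have e : {k : ℕ | μ k ≤ t} = ↑(s.filter fun k => μ k ≤ t) := by
    ext k
    simp only [Set.mem_ofPred_eq, Finset.coe_filter]
    refine ⟨fun h => ⟨?_, h⟩, fun h => h.2⟩
    by_contra hk
    linarith [hs k hk]
  rw [e, Set.ncard_coe_finset, Finset.card_filter]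
  push_cast
  rfl

/-- An upper bound on the growth of the counting function, up to an additive constant. -/
lemma exists_ncard_le {μ : ℕ → ℝ} (htend : Tendsto μ atTop atTop) {a W W' : ℝ}
    (hWW : W < W') (hW' : 0 ≤ W')
    (hN : Tendsto (fun lam : ℝ => (Set.ncard {k : ℕ | μ k ≤ lam} : ℝ) / lam ^ a)
      atTop (𝓝 W)) :
    ∃ C : ℝ, ∀ t, 0 ≤ t → (Set.ncard {k : ℕ | μ k ≤ t} : ℝ) ≤ W' * t ^ a + C := by
  obtain ⟨T, hT⟩ := eventually_atTop.1 (hN.eventually_lt_const hWW)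
  set T' := max T 1
  refine ⟨Set.ncard {k : ℕ | μ k ≤ T'}, fun t ht => ?_⟩
  rcases le_total T' t with h | h
  · have ht0 : 0 < t := lt_of_lt_of_le one_pos ((le_max_right _ _).trans h)
    have := (div_lt_iff₀ (Real.rpow_pos_of_pos ht0 a)).1 (hT t ((le_max_left _ _).trans h))
    exact this.le.trans (le_add_of_nonneg_right (Nat.cast_nonneg _))
  · obtain ⟨K, hK⟩ := exists_forall_lt_of_tendsto htend T'
    have hfin : {k : ℕ | μ k ≤ T'}.Finite := by
      refine (Finset.range K).finite_toSet.subset fun k hk => ?_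
      by_contra hk'
      exact absurd (hK k hk') (not_lt.2 hk)
    have : (Set.ncard {k : ℕ | μ k ≤ t} : ℝ) ≤ Set.ncard {k : ℕ | μ k ≤ T'} := by
      exact_mod_cast Set.ncard_le_ncard (fun k hk => le_trans hk h) hfin
    exact this.trans (le_add_of_nonneg_left (by positivity))

lemma rieszMean_two_le_of_ncard_le {μ : ℕ → ℝ} (hpos : ∀ k, 0 < μ k)
    (htend : Tendsto μ atTop atTop) {a W C : ℝ} (ha : 0 < a)
    (hC : ∀ t, 0 ≤ t → (Set.ncard {k : ℕ | μ k ≤ t} : ℝ) ≤ W * t ^ a + C)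
    {z : ℝ} (hz : 0 < z) :
    rieszMean μ 2 z ≤
      Real.Gamma 3 * Real.Gamma (1 + a) / Real.Gamma (3 + a) * W * z ^ (2 + a) + C * z ^ 2 := by
  obtain ⟨K, hK⟩ := exists_forall_lt_of_tendsto htend z
  have hcont : Continuous fun t : ℝ => t ^ a := Real.continuous_rpow_const ha.le
  have hbeta := integral_rpow_mul_sub_rpow (u := 1 + a) (v := 2) (by linarith) two_pos hz
  have hlin : ∫ t in (0 : ℝ)..z, (z - t) = z ^ 2 / 2 := by
    have e := intervalIntegral.integral_comp_sub_left (a := 0) (b := z) (fun x => x) z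
    rw [e]
    simp
  calc rieszMean μ 2 z
      = ∑ k ∈ Finset.range K, max (z - μ k) 0 ^ (2 : ℝ) := rieszMean_eq_sum hK two_pos le_rfl
    _ = ∫ t in (0 : ℝ)..z, ∑ k ∈ Finset.range K, (if μ k ≤ t then 1 else 0) * (2 * (z - t)) := by
        rw [intervalIntegral.integral_finsetSum fun k _ =>
          intervalIntegrable_indicator_mul_sub _ _ _ _]
        exact Finset.sum_congr rfl fun k _ => max_sq_eq_integral (hpos k).le hz.le
    _ ≤ ∫ t in (0 : ℝ)..z, (W * t ^ a + C) * (2 * (z - t)) := by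
        refine intervalIntegral.integral_mono_on hz.le ?_ ?_ fun t ht => ?_
        · simpa only [Finset.sum_fn] using IntervalIntegrable.sum (Finset.range K) fun k _ =>
            intervalIntegrable_indicator_mul_sub (μ k) z 0 z
        · exact Continuous.intervalIntegrable (by fun_prop) _ _
        · rw [← Finset.sum_mul, ← ncard_eq_sum hK ht.2]
          exact mul_le_mul_of_nonneg_right (hC t ht.1) (by linarith [ht.2])
    _ = ∫ t in (0 : ℝ)..z,
          (2 * W * (t ^ (1 + a - 1) * (z - t) ^ ((2 : ℝ) - 1)) + 2 * C * (z - t)) := by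
        refine intervalIntegral.integral_congr fun t _ => ?_
        norm_num
        ring
    _ = _ := by
        rw [intervalIntegral.integral_add, intervalIntegral.integral_const_mul,
          intervalIntegral.integral_const_mul, hbeta, hlin]
        · rw [show 1 + a + 2 - 1 = 2 + a by ring, show 1 + a + 2 = 3 + a by ring,
            show (3 : ℝ) = 2 + 1 by norm_num, Real.Gamma_add_one two_ne_zero, Real.Gamma_two]
          ring
        · refine Continuous.intervalIntegrable ?_ _ _
          norm_num
          fun_prop
        · exact Continuous.intervalIntegrable (by fun_prop) _ _

/-- Under the universal inequality, `R₂(z) / z ^ (2 + n / 2)` is nondecreasing. -/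
lemma monotoneOn_rieszMean_two_mul_rpow {n : ℝ} (hn : 0 < n) {μ : ℕ → ℝ}
    (htend : Tendsto μ atTop atTop)
    (hR2 : ∀ z : ℝ, 0 ≤ z →
      rieszMean μ 2 z ≤ (4 / n) * ∑' k : ℕ, (max (z - μ k) 0) * μ k) :
    MonotoneOn (fun z => rieszMean μ 2 z * z ^ (-(2 + n / 2))) (Set.Ioi 0) := by
  intro x hx Z hZ hxZ
  obtain ⟨K, hK⟩ := exists_forall_lt_of_tendsto htend Z
  set f : ℝ → ℝ := fun t => ∑ k ∈ Finset.range K, max (t - μ k) 0 ^ (2 : ℝ)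
  have hf : ∀ t ≤ Z, rieszMean μ 2 t = f t := fun t ht => rieszMean_eq_sum hK two_pos ht
  have hderiv : ∀ t, 0 < t → HasDerivAt (fun t => f t * t ^ (-(2 + n / 2)))
      ((∑ k ∈ Finset.range K, 2 * max (t - μ k) 0) * t ^ (-(2 + n / 2)) +
        f t * (-(2 + n / 2) * t ^ (-(2 + n / 2) - 1))) t := fun t ht =>
    (HasDerivAt.fun_sum fun k _ => hasDerivAt_max_sq (μ k) t).mul
      (Real.hasDerivAt_rpow_const (Or.inl ht.ne'))
  have hineq : ∀ t, 0 < t → t ≤ Z →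
      (2 + n / 2) * f t ≤ t * ∑ k ∈ Finset.range K, 2 * max (t - μ k) 0 := by
    intro t ht htZ
    have h := hR2 t ht.le
    rw [hf t htZ, tsum_eq_sum (s := Finset.range K) fun k hk => by
      rw [max_eq_right (by linarith [hK k hk]), zero_mul]] at h
    have e : ∑ k ∈ Finset.range K, max (t - μ k) 0 * μ k =
        t * (∑ k ∈ Finset.range K, max (t - μ k) 0) - f t := by
      rw [Finset.mul_sum, ← Finset.sum_sub_distrib]
      refine Finset.sum_congr rfl fun k _ => ?_
      rw [Real.rpow_two]
      rcases le_total (t - μ k) 0 with h0 | h0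
      · simp [max_eq_right h0]
      · rw [max_eq_left h0]
        ring
    rw [e, div_mul_eq_mul_div, le_div_iff₀ hn] at h
    rw [← Finset.mul_sum]
    linarith
  have hmono : MonotoneOn (fun t => f t * t ^ (-(2 + n / 2))) (Set.Icc x Z) := by
    have hpos : ∀ t ∈ Set.Icc x Z, 0 < t := fun t ht => lt_of_lt_of_le hx ht.1
    refine monotoneOn_of_deriv_nonneg (convex_Icc x Z)
      (fun t ht => (hderiv t (hpos t ht)).continuousAt.continuousWithinAt)
      (fun t ht => (hderiv t (hpos t
        (interior_subset ht))).differentiableAt.differentiableWithinAt)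
      fun t ht => ?_
    have ht' := interior_subset ht
    have ht0 := hpos t ht'
    rw [(hderiv t ht0).deriv]
    have hp : t ^ (-(2 + n / 2)) = t * t ^ (-(2 + n / 2) - 1) := by
      rw [Real.rpow_sub_one ht0.ne']
      field_simp
    rw [hp]
    nlinarith [mul_le_mul_of_nonneg_right (hineq t ht0 ht'.2)
      (Real.rpow_nonneg ht0.le (-(2 + n / 2) - 1))]
  have h := hmono (Set.left_mem_Icc.2 hxZ) (Set.right_mem_Icc.2 hxZ) hxZ
  simpa only [hf x hxZ, hf Z le_rfl] using h

/-- The Berezin–Li–Yau inequality for the Riesz mean of order `2`. -/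
lemma rieszMean_two_le {n W : ℝ} (hn : 0 < n) (hW : 0 < W) {μ : ℕ → ℝ}
    (hpos : ∀ k, 0 < μ k) (htend : Tendsto μ atTop atTop)
    (hR2 : ∀ z : ℝ, 0 ≤ z →
      rieszMean μ 2 z ≤ (4 / n) * ∑' k : ℕ, (max (z - μ k) 0) * μ k)
    (hN : Tendsto (fun lam : ℝ => (Set.ncard {k : ℕ | μ k ≤ lam} : ℝ) / lam ^ (n / 2))
      atTop (𝓝 W)) {z : ℝ} (hz : 0 < z) :
    rieszMean μ 2 z ≤
      Real.Gamma 3 * Real.Gamma (1 + n / 2) / Real.Gamma (3 + n / 2) * W * z ^ (2 + n / 2) := by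
  have ha : 0 < n / 2 := by positivity
  set B := Real.Gamma 3 * Real.Gamma (1 + n / 2) / Real.Gamma (3 + n / 2)
  have key : ∀ W' : ℝ, W < W' → rieszMean μ 2 z * z ^ (-(2 + n / 2)) ≤ B * W' := by
    intro W' hWW
    obtain ⟨C, hC⟩ := exists_ncard_le htend hWW (hW.trans hWW).le hN
    have hlim : Tendsto (fun Z : ℝ => B * W' + C * Z ^ (-(n / 2))) atTop (𝓝 (B * W')) := by
      simpa using ((tendsto_rpow_neg_atTop ha).const_mul C).const_add (B * W')
    refine ge_of_tendsto hlim ?_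
    filter_upwards [eventually_ge_atTop z] with Z hzZ
    have hZ := hz.trans_le hzZ
    refine (monotoneOn_rieszMean_two_mul_rpow hn htend hR2 hz hZ hzZ).trans ?_
    refine (mul_le_mul_of_nonneg_right (rieszMean_two_le_of_ncard_le hpos htend ha hC hZ)
      (Real.rpow_nonneg hZ.le _)).trans_eq ?_
    rw [add_mul, mul_assoc _ (Z ^ (2 + n / 2)), mul_assoc C, ← Real.rpow_add hZ,
      ← Real.rpow_two, ← Real.rpow_add hZ, add_neg_cancel, Real.rpow_zero, mul_one,
      neg_add, add_neg_cancel_left]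
  have hlim : Tendsto (fun W' : ℝ => B * W') (𝓝[>] W) (𝓝 (B * W)) :=
    ((continuous_const_mul B).tendsto W).mono_left nhdsWithin_le_nhds
  have h := ge_of_tendsto hlim (eventually_nhdsWithin_of_forall key)
  rwa [Real.rpow_neg hz.le, ← div_eq_mul_inv, div_le_iff₀ (Real.rpow_pos_of_pos hz _)] at h

/-- Riesz iteration transfers a power bound from order `2` to every higher order. -/
lemma rieszMean_le_of_rieszMean_two_le {μ : ℕ → ℝ} (hpos : ∀ k, 0 < μ k)
    (htend : Tendsto μ atTop atTop) {a D : ℝ} (ha : 0 < a)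
    (hD : ∀ t, 0 < t → rieszMean μ 2 t ≤ D * t ^ (2 + a)) {ρ z : ℝ} (hρ : 2 < ρ) (hz : 0 < z) :
    rieszMean μ ρ z ≤ Real.Gamma (ρ + 1) * Real.Gamma (3 + a) /
      (Real.Gamma 3 * Real.Gamma (ρ + 1 + a)) * D * z ^ (ρ + a) := by
  obtain ⟨K, hK⟩ := exists_forall_lt_of_tendsto htend z
  have hv : 0 < ρ - 2 := by linarith
  have hbeta := integral_rpow_mul_sub_rpow (u := 3 + a) (by linarith) hv hz
  have hcont : ∀ k, Continuous fun t : ℝ => max (t - μ k) 0 ^ (2 : ℝ) := fun k =>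
    ((continuous_id.sub continuous_const).max continuous_const).rpow_const
      fun _ => Or.inr two_pos.le
  have hcont' : Continuous fun t : ℝ => D * t ^ (2 + a) :=
    continuous_const.mul (Real.continuous_rpow_const (by linarith))
  have hcontsum : Continuous fun t : ℝ => ∑ k ∈ Finset.range K, max (t - μ k) 0 ^ (2 : ℝ) :=
    continuous_finsetSum _ fun k _ => hcont k
  have hiter : ∀ k, ∫ t in (0 : ℝ)..z, max (t - μ k) 0 ^ (2 : ℝ) * (z - t) ^ (ρ - 2 - 1) =
      Real.Gamma 3 * Real.Gamma (ρ - 2) / Real.Gamma (ρ + 1) * max (z - μ k) 0 ^ ρ := by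
    intro k
    have h := integral_max_rpow_mul_sub_rpow (u := 3) (by norm_num) hv (hpos k).le hz.le
    rwa [show (3 : ℝ) - 1 = 2 by norm_num, show 3 + (ρ - 2) - 1 = ρ by ring,
      show 3 + (ρ - 2) = ρ + 1 by ring] at h
  have h3 : 0 < Real.Gamma 3 := Real.Gamma_pos_of_pos (by norm_num)
  have hG : 0 < Real.Gamma (ρ - 2) := Real.Gamma_pos_of_pos hv
  have hG1 : 0 < Real.Gamma (ρ + 1) := Real.Gamma_pos_of_pos (by linarith)
  have hGa : 0 < Real.Gamma (ρ + 1 + a) := Real.Gamma_pos_of_pos (by linarith)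
  have hmain : Real.Gamma 3 * Real.Gamma (ρ - 2) / Real.Gamma (ρ + 1) * rieszMean μ ρ z ≤
      D * (Real.Gamma (3 + a) * Real.Gamma (ρ - 2) / Real.Gamma (ρ + 1 + a) * z ^ (ρ + a)) :=
    calc Real.Gamma 3 * Real.Gamma (ρ - 2) / Real.Gamma (ρ + 1) * rieszMean μ ρ z
        = ∑ k ∈ Finset.range K,
            ∫ t in (0 : ℝ)..z, max (t - μ k) 0 ^ (2 : ℝ) * (z - t) ^ (ρ - 2 - 1) := by
          rw [rieszMean_eq_sum hK (by linarith) le_rfl, Finset.mul_sum]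
          exact Finset.sum_congr rfl fun k _ => (hiter k).symm
      _ = ∫ t in (0 : ℝ)..z,
            (∑ k ∈ Finset.range K, max (t - μ k) 0 ^ (2 : ℝ)) * (z - t) ^ (ρ - 2 - 1) := by
          simp_rw [Finset.sum_mul]
          exact (intervalIntegral.integral_finsetSum fun k _ =>
            intervalIntegrable_mul_sub_rpow (hcont k) hv _ _ _).symm
      _ ≤ ∫ t in (0 : ℝ)..z, D * t ^ (2 + a) * (z - t) ^ (ρ - 2 - 1) := by
          refine intervalIntegral.integral_mono_on_of_le_Ioo hz.le
            (intervalIntegrable_mul_sub_rpow hcontsum hv _ _ _)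
            (intervalIntegrable_mul_sub_rpow hcont' hv _ _ _) fun t ht => ?_
          rw [← rieszMean_eq_sum hK two_pos ht.2.le]
          exact mul_le_mul_of_nonneg_right (hD t ht.1)
            (Real.rpow_nonneg (by linarith [ht.2]) _)
      _ = _ := by
          simp_rw [mul_assoc]
          rw [intervalIntegral.integral_const_mul]
          rw [show 3 + a - 1 = 2 + a by ring, show 3 + a + (ρ - 2) = ρ + 1 + a by ring,
            show ρ + 1 + a - 1 = ρ + a by ring] at hbeta
          rw [hbeta]
  rw [← le_div_iff₀' (by positivity)] at hmain
  refine hmain.trans_eq ?_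
  field_simp

/-- Abstract Berezin–Li–Yau inequality: if `R₂(z) ≤ (4/n) ∑ (z − μ_k)₊ μ_k`
for all `z ≥ 0` and the counting function satisfies `N(λ)/λ^{n/2} → W`, then
for every `ρ ≥ 2` and `z > 0`,
`R_ρ(z) ≤ (Γ(ρ+1) Γ(1 + n/2)/Γ(ρ + 1 + n/2)) W z^{ρ + n/2}`. -/
theorem abstract_berezin_li_yau
    (n W : ℝ) (hn : 0 < n) (hW : 0 < W) (μ : ℕ → ℝ)
    (hpos : ∀ k, 0 < μ k) (hmono : Monotone μ)
    (htend : Filter.Tendsto μ Filter.atTop Filter.atTop)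
    (hR2 : ∀ z : ℝ, 0 ≤ z →
      rieszMean μ 2 z ≤ (4 / n) * ∑' k : ℕ, (max (z - μ k) 0) * μ k)
    (hN : Filter.Tendsto
      (fun lam : ℝ => (Set.ncard {k : ℕ | μ k ≤ lam} : ℝ) / lam ^ (n / 2))
      Filter.atTop (nhds W)) :
    ∀ ρ : ℝ, 2 ≤ ρ → ∀ z : ℝ, 0 < z →
      rieszMean μ ρ z ≤
        Real.Gamma (ρ + 1) * Real.Gamma (1 + n / 2) / Real.Gamma (ρ + 1 + n / 2) *
          W * z ^ (ρ + n / 2) := by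

  intro ρ hρ z hz
  have h2 := fun (t : ℝ) (ht : 0 < t) => rieszMean_two_le hn hW hpos htend hR2 hN ht
  rcases hρ.eq_or_lt with rfl | hρ
  · rw [show (2 : ℝ) + 1 = 3 by norm_num]
    exact h2 z hz
  · refine (rieszMean_le_of_rieszMean_two_le hpos htend (by positivity) h2 hρ hz).trans_eq ?_
    have h3 : 0 < Real.Gamma 3 := Real.Gamma_pos_of_pos (by norm_num)
    have h3a : 0 < Real.Gamma (3 + n / 2) := Real.Gamma_pos_of_pos (by positivity)
    field_simp
end

section
/- Abstract Kac-type heat trace bound (analytic core of the main theorem): Let n > 0 and W > 0 be real numbers and (μ_k)_{k≥1} a nondecreasing sequence of positive real numbers tending to infinity such that (i) R_2(z) ≤ (4/n) ∑_{k≥1} (z − μ_k)_+ μ_k for every z ≥ 0, and (ii) the counting function satisfies N(λ)/λ^{n/2} → W as λ → ∞. Then for every t > 0, ∑_{k≥1} e^{−μ_k t} ≤ Γ(1 + n/2) · W · t^{−n/2}. (For the shifted Dirichlet eigenvalues μ_k = λ_k + n²H_0²/4 of a bounded domain Ω in an n-dimensional complete Riemannian manifold, where W = ω_n|Ω|/(2π)^n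 by Weyl's law, this yields Z_H(t) ≤ |Ω|/(4πt)^{n/2}.) -/
open MeasureTheory Filter Topology

/-- The Laplace transform of a shifted truncated power is integrable. -/
theorem integrable_max_sub_rpow_mul_exp {j t : ℝ} (hj : 0 < j) (ht : 0 < t) (a : ℝ) :
    Integrable (fun z : ℝ => (max (z - a) 0) ^ j * Real.exp (-(t * z))) := by
  have base : Integrable (fun z : ℝ => (max z 0) ^ j * Real.exp (-(t * z))) := by
    have h : IntegrableOn (fun z : ℝ => z ^ j * Real.exp (-(t * z))) (Set.Ioi 0) := by
      simpa using integrableOn_rpow_mul_exp_neg_mul_rpow (p := 1) (s := j) (b := t)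
        (by linarith) one_pos ht
    refine (h.integrable_indicator measurableSet_Ioi).congr (Eventually.of_forall fun z => ?_)
    rcases lt_or_ge 0 z with hz | hz
    · simp [hz, hz.le]
    · simp [hz, hz.not_gt, Real.zero_rpow hj.ne']
  refine ((base.comp_sub_right a).mul_const (Real.exp (-(t * a)))).congr
    (Eventually.of_forall fun z => ?_)
  simp only [mul_assoc, ← Real.exp_add]
  ring_nf

/-- The Laplace transform of a shifted truncated power. -/
theorem integral_max_sub_rpow_mul_exp {j t : ℝ} (hj : 0 < j) (ht : 0 < t) (a : ℝ) :
    ∫ z : ℝ, (max (z - a) 0) ^ j * Real.exp (-(t * z)) =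
      (1 / t) ^ (j + 1) * Real.Gamma (j + 1) * Real.exp (-(t * a)) := by
  have base : ∫ z : ℝ, (max z 0) ^ j * Real.exp (-(t * z)) =
      (1 / t) ^ (j + 1) * Real.Gamma (j + 1) := by
    rw [← Real.integral_rpow_mul_exp_neg_mul_Ioi (by linarith) ht,
      ← integral_indicator measurableSet_Ioi]
    congr 1 with z
    rcases lt_or_ge 0 z with hz | hz
    · simp [hz, hz.le]
    · simp [hz, hz.not_gt, Real.zero_rpow hj.ne']
  rw [← base, ← integral_sub_right_eq_self
      (fun z : ℝ => (max z 0) ^ j * Real.exp (-(t * z))) a, ← integral_mul_const]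
  congr 1 with z
  simp only [mul_assoc, ← Real.exp_add]
  ring_nf

/-- A bound on the counting function gives a bound on the partial sums of the heat trace. -/
theorem sum_exp_le_of_counting_le {μ : ℕ → ℝ} (hpos : ∀ k, 0 < μ k)
    (htend : Tendsto μ atTop atTop) {m C V : ℝ} (hm : 0 < m)
    (hb : ∀ z : ℝ, 0 < z → (Set.ncard {k : ℕ | μ k ≤ z} : ℝ) ≤ C + V * z ^ m)
    {t : ℝ} (ht : 0 < t) (K : ℕ) :
    ∑ k ∈ Finset.range K, Real.exp (-(μ k * t)) ≤
      C + V * (Real.Gamma (1 + m) * t ^ (-m)) := by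
  have hint (k : ℕ) : IntegrableOn
      ((Set.Ioi (μ k)).indicator fun z => Real.exp (-t * z)) (Set.Ioi 0) :=
    (((integrableOn_exp_mul_Ioi (neg_lt_zero.2 ht) 0).integrable).indicator measurableSet_Ioi)
  have hval (k : ℕ) : Real.exp (-(μ k * t)) =
      t * ∫ z in Set.Ioi (0 : ℝ), (Set.Ioi (μ k)).indicator (fun z => Real.exp (-t * z)) z := by
    rw [setIntegral_indicator measurableSet_Ioi,
      Set.inter_eq_right.2 (Set.Ioi_subset_Ioi (hpos k).le),
      integral_exp_mul_Ioi (neg_lt_zero.2 ht)]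
    field_simp
  have h0 : IntegrableOn (fun z : ℝ => Real.exp (-t * z)) (Set.Ioi 0) :=
    integrableOn_exp_mul_Ioi (neg_lt_zero.2 ht) 0
  have h1 : IntegrableOn (fun z : ℝ => z ^ m * Real.exp (-t * z)) (Set.Ioi 0) := by
    simpa using integrableOn_rpow_mul_exp_neg_mul_rpow (p := 1) (s := m) (b := t)
      (by linarith) one_pos ht
  have hmono : ∫ z in Set.Ioi (0 : ℝ), ∑ k ∈ Finset.range K,
      (Set.Ioi (μ k)).indicator (fun z => Real.exp (-t * z)) z ≤
      ∫ z in Set.Ioi (0 : ℝ),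
        (C * Real.exp (-t * z) + V * (z ^ m * Real.exp (-t * z))) := by
    refine setIntegral_mono_on (integrable_finsetSum _ fun k _ => hint k)
      ((h0.const_mul C).add (h1.const_mul V)) measurableSet_Ioi fun z hz => ?_
    have hfin : {k : ℕ | μ k ≤ z}.Finite := by
      have h := htend.eventually_gt_atTop z
      rw [← Nat.cofinite_eq_atTop] at h
      simpa [eventually_cofinite] using h
    have hcard : (((Finset.range K).filter fun k => μ k < z).card : ℝ) ≤
        (Set.ncard {k : ℕ | μ k ≤ z} : ℝ) := by
      rw [← Set.ncard_coe_finset]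
      refine Nat.cast_le.2 (Set.ncard_le_ncard (fun k hk => ?_) hfin)
      exact (Finset.mem_filter.1 hk).2.le
    calc ∑ k ∈ Finset.range K, (Set.Ioi (μ k)).indicator (fun z => Real.exp (-t * z)) z
        = ((Finset.range K).filter fun k => μ k < z).card * Real.exp (-t * z) := by
          simp [Set.indicator_apply, Finset.sum_ite]
      _ ≤ (C + V * z ^ m) * Real.exp (-t * z) := by
          gcongr
          exact hcard.trans (hb z hz)
      _ = _ := by ring
  have hgamma : ∫ z in Set.Ioi (0 : ℝ), z ^ m * Real.exp (-t * z) =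
      (1 / t) ^ (m + 1) * Real.Gamma (m + 1) := by
    simpa using Real.integral_rpow_mul_exp_neg_mul_Ioi (a := m + 1) (by linarith) ht
  have hexp : ∫ z in Set.Ioi (0 : ℝ), Real.exp (-t * z) = 1 / t := by
    rw [integral_exp_mul_Ioi (neg_lt_zero.2 ht)]
    simp
  rw [integral_finsetSum _ fun k _ => hint k,
    integral_add (h0.const_mul C) (h1.const_mul V), integral_const_mul, integral_const_mul,
    hgamma, hexp] at hmono
  simp_rw [hval, ← Finset.mul_sum]
  refine (mul_le_mul_of_nonneg_left hmono ht.le).trans_eq ?_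
  rw [one_div, Real.inv_rpow ht.le, Real.rpow_add_one ht.ne', Real.rpow_neg ht.le, add_comm m]
  have := (Real.rpow_pos_of_pos ht m).ne'
  field_simp

/-- An eventual asymptotic bound on the counting function upgrades to a bound for all `z > 0`. -/
theorem exists_counting_le {μ : ℕ → ℝ} (htend : Tendsto μ atTop atTop) {m V W : ℝ}
    (hW : 0 < W) (hV : W < V)
    (hN : Tendsto (fun lam : ℝ => (Set.ncard {k : ℕ | μ k ≤ lam} : ℝ) / lam ^ m)
      atTop (𝓝 W)) :
    ∃ C : ℝ, ∀ z : ℝ, 0 < z → (Set.ncard {k : ℕ | μ k ≤ z} : ℝ) ≤ C + V * z ^ m := by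
  obtain ⟨z₀, hz₀⟩ := eventually_atTop.1 (hN.eventually_lt_const hV)
  have hfin : {k : ℕ | μ k ≤ z₀}.Finite := by
    have h := htend.eventually_gt_atTop z₀
    rw [← Nat.cofinite_eq_atTop] at h
    simpa [eventually_cofinite] using h
  refine ⟨Set.ncard {k : ℕ | μ k ≤ z₀}, fun z hz => ?_⟩
  have hp := Real.rpow_pos_of_pos hz m
  rcases le_total z z₀ with h | h
  · have : (Set.ncard {k : ℕ | μ k ≤ z} : ℝ) ≤ Set.ncard {k : ℕ | μ k ≤ z₀} := by
      exact_mod_cast Set.ncard_le_ncard (fun k (hk : μ k ≤ z) => hk.trans h) hfin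
    have : 0 ≤ V * z ^ m := mul_nonneg (hW.trans hV).le hp.le
    linarith
  · have := (div_lt_iff₀ hp).1 (hz₀ z h)
    have : (0 : ℝ) ≤ Set.ncard {k : ℕ | μ k ≤ z₀} := Nat.cast_nonneg _
    linarith

/-- `x e^{-xt}` is dominated by a multiple of `e^{-xs}` when `s < t`. -/
theorem mul_exp_le_of_lt {x s t : ℝ} (hst : s < t) :
    x * Real.exp (-(x * t)) ≤ (t - s)⁻¹ * Real.exp (-(x * s)) := by
  have h : x * (t - s) ≤ Real.exp (x * (t - s)) := by
    linarith [Real.add_one_le_exp (x * (t - s))]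
  have hd : 0 < t - s := sub_pos.2 hst
  have he : Real.exp (-(x * s)) = Real.exp (x * (t - s)) * Real.exp (-(x * t)) := by
    rw [← Real.exp_add]
    ring_nf
  rw [he, inv_mul_eq_div, le_div_iff₀ hd]
  nlinarith [Real.exp_pos (-(x * t))]

theorem summable_mul_exp {μ : ℕ → ℝ} (hpos : ∀ k, 0 < μ k)
    (hsum : ∀ t : ℝ, 0 < t → Summable fun k => Real.exp (-(μ k * t))) {t : ℝ} (ht : 0 < t) :
    Summable fun k => μ k * Real.exp (-(μ k * t)) :=
  ((hsum (t / 2) (half_pos ht)).mul_left (t - t / 2)⁻¹).of_nonneg_of_le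
    (fun k => mul_nonneg (hpos k).le (Real.exp_pos _).le)
    fun _ => mul_exp_le_of_lt (half_lt_self ht)

/-- The heat trace may be differentiated term by term. -/
theorem hasDerivAt_tsum_exp {μ : ℕ → ℝ} (hpos : ∀ k, 0 < μ k)
    (hsum : ∀ t : ℝ, 0 < t → Summable fun k => Real.exp (-(μ k * t))) {t : ℝ} (ht : 0 < t) :
    HasDerivAt (fun s => ∑' k, Real.exp (-(μ k * s)))
      (-∑' k, μ k * Real.exp (-(μ k * t))) t := by
  rw [← tsum_neg]
  have hmem : t ∈ Set.Ioi (t / 2) := half_lt_self ht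
  refine hasDerivAt_tsum_of_isPreconnected
    (g' := fun k s => -(μ k * Real.exp (-(μ k * s))))
    (summable_mul_exp hpos hsum (half_pos ht)) isOpen_Ioi
    isPreconnected_Ioi (fun k s _ => ?_) (fun k s hs => ?_) hmem (hsum t ht) hmem
  · have h := ((hasDerivAt_id' s).const_mul (μ k)).fun_neg.exp
    rwa [mul_one, mul_neg, mul_comm] at h
  · rw [norm_neg, Real.norm_of_nonneg (mul_nonneg (hpos k).le (Real.exp_pos _).le)]
    have := hpos k
    have : t / 2 < s := hs
    gcongr

/-- The Laplace transform of the Riesz mean inequality. -/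
theorem tsum_exp_le_mul_tsum_mul_exp {c : ℝ} {μ : ℕ → ℝ} (hpos : ∀ k, 0 < μ k)
    (hsum : ∀ t : ℝ, 0 < t → Summable fun k => Real.exp (-(μ k * t)))
    (hR2 : ∀ z : ℝ, 0 ≤ z →
      rieszMean μ 2 z ≤ c * ∑' k : ℕ, (max (z - μ k) 0) * μ k) {t : ℝ} (ht : 0 < t) :
    2 * ∑' k, Real.exp (-(μ k * t)) ≤ c * t * ∑' k, μ k * Real.exp (-(μ k * t)) := by
  have hF2 (k : ℕ) := integrable_max_sub_rpow_mul_exp two_pos ht (μ k)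
  have hF1 (k : ℕ) : Integrable
      (fun z : ℝ => max (z - μ k) 0 * μ k * Real.exp (-(t * z))) := by
    convert (integrable_max_sub_rpow_mul_exp one_pos ht (μ k)).mul_const (μ k) using 2 with z
    rw [Real.rpow_one]
    ring
  have hI2 (k : ℕ) : ∫ z : ℝ, (max (z - μ k) 0) ^ (2 : ℝ) * Real.exp (-(t * z)) =
      2 * (1 / t) ^ 3 * Real.exp (-(μ k * t)) := by
    rw [integral_max_sub_rpow_mul_exp two_pos ht,
      show (2 + 1 : ℝ) = ((2 : ℕ) : ℝ) + 1 by norm_num, Real.Gamma_nat_eq_factorial,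
      show ((2 : ℕ) : ℝ) + 1 = ((3 : ℕ) : ℝ) by norm_num, Real.rpow_natCast, mul_comm t]
    norm_num [Nat.factorial]
    ring
  have hI1 (k : ℕ) : ∫ z : ℝ, max (z - μ k) 0 * μ k * Real.exp (-(t * z)) =
      (1 / t) ^ 2 * (μ k * Real.exp (-(μ k * t))) := by
    have h := integral_max_sub_rpow_mul_exp one_pos ht (μ k)
    rw [one_add_one_eq_two, Real.Gamma_two, Real.rpow_two, mul_comm t] at h
    calc _ = ∫ z : ℝ, (max (z - μ k) 0) ^ (1 : ℝ) * Real.exp (-(t * z)) * μ k := by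
          congr 1 with z
          rw [Real.rpow_one]
          ring
      _ = _ := by
          rw [integral_mul_const, h]
          ring
  have hn2 (k : ℕ) (z : ℝ) : 0 ≤ (max (z - μ k) 0) ^ (2 : ℝ) * Real.exp (-(t * z)) := by
    positivity
  have hn1 (k : ℕ) (z : ℝ) : 0 ≤ max (z - μ k) 0 * μ k * Real.exp (-(t * z)) := by
    have := hpos k
    positivity
  have hS2 := hasSum_integral_of_summable_integral_norm hF2 (by
    simp_rw [Real.norm_of_nonneg (hn2 _ _), hI2]
    exact (hsum t ht).mul_left _)
  have hS1 := hasSum_integral_of_summable_integral_norm hF1 (by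
    simp_rw [Real.norm_of_nonneg (hn1 _ _), hI1]
    exact (summable_mul_exp hpos hsum ht).mul_left _)
  simp_rw [hI2] at hS2
  simp_rw [hI1] at hS1
  have hpos1 : 0 < ∫ z : ℝ, ∑' k, max (z - μ k) 0 * μ k * Real.exp (-(t * z)) := by
    rw [← hS1.tsum_eq]
    have h (k : ℕ) : 0 < (1 / t) ^ 2 * (μ k * Real.exp (-(μ k * t))) := by
      have := hpos k
      positivity
    exact hS1.summable.tsum_pos (fun k => (h k).le) 0 (h 0)
  have hint1 : Integrable fun z : ℝ => ∑' k, max (z - μ k) 0 * μ k * Real.exp (-(t * z)) :=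
    not_imp_comm.1 integral_undef hpos1.ne'
  have key : ∫ z : ℝ, ∑' k, (max (z - μ k) 0) ^ (2 : ℝ) * Real.exp (-(t * z)) ≤
      ∫ z : ℝ, c * ∑' k, max (z - μ k) 0 * μ k * Real.exp (-(t * z)) := by
    refine integral_mono_of_nonneg (Eventually.of_forall fun z => tsum_nonneg fun k => hn2 k z)
      (hint1.const_mul c) (Eventually.of_forall fun z => ?_)
    simp only [tsum_mul_right, ← mul_assoc]
    refine mul_le_mul_of_nonneg_right ?_ (Real.exp_pos _).le
    rcases le_total 0 z with hz | hz
    · exact hR2 z hz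
    · have h (k : ℕ) : max (z - μ k) 0 = 0 := max_eq_right (by linarith [hpos k])
      simp [h]
  rw [integral_const_mul, ← hS2.tsum_eq, ← hS1.tsum_eq, tsum_mul_left, tsum_mul_left] at key
  have h3 := mul_le_mul_of_nonneg_right key (pow_pos ht 3).le
  calc _ = 2 * (1 / t) ^ 3 * (∑' k, Real.exp (-(μ k * t))) * t ^ 3 := by
        generalize ∑' k, Real.exp (-(μ k * t)) = x
        field_simp
    _ ≤ _ := h3
    _ = _ := by
        generalize ∑' k, μ k * Real.exp (-(μ k * t)) = x
        field_simp

/-- If `m Z ≤ -t Z'` on `(0, ∞)`, then `t ^ m * Z t` is nonincreasing there. -/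
theorem antitoneOn_rpow_mul {Z Z' : ℝ → ℝ} {m : ℝ}
    (hZ : ∀ t, 0 < t → HasDerivAt Z (Z' t) t) (h : ∀ t, 0 < t → m * Z t ≤ -(t * Z' t)) :
    AntitoneOn (fun t => t ^ m * Z t) (Set.Ioi 0) := by
  have hd (t : ℝ) (ht : 0 < t) : HasDerivAt (fun t => t ^ m * Z t)
      (m * t ^ (m - 1) * Z t + t ^ m * Z' t) t :=
    (Real.hasDerivAt_rpow_const (Or.inl ht.ne')).mul (hZ t ht)
  refine antitoneOn_of_deriv_nonpos (convex_Ioi 0)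
    (fun t ht => (hd t ht).continuousAt.continuousWithinAt) ?_ ?_ <;> rw [interior_Ioi]
  · exact fun t ht => (hd t ht).differentiableAt.differentiableWithinAt
  · intro t ht
    have ht : 0 < t := ht
    have hp := Real.rpow_pos_of_pos ht (m - 1)
    have he : t ^ m = t ^ (m - 1) * t := by
      rw [← Real.rpow_add_one ht.ne', sub_add_cancel]
    rw [(hd t ht).deriv, he]
    nlinarith [h t ht]

/-- Abstract Kac-type heat trace bound: if `R₂(z) ≤ (4/n) ∑ (z − μ_k)₊ μ_k`
for all `z ≥ 0` and the counting function satisfies `N(λ)/λ^{n/2} → W`, then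
for every `t > 0`, `∑ e^{−μ_k t} ≤ Γ(1 + n/2) W t^{−n/2}`. -/
theorem abstract_kac_heat_trace_bound
    (n W : ℝ) (hn : 0 < n) (hW : 0 < W) (μ : ℕ → ℝ)
    (hpos : ∀ k, 0 < μ k) (hmono : Monotone μ)
    (htend : Filter.Tendsto μ Filter.atTop Filter.atTop)
    (hR2 : ∀ z : ℝ, 0 ≤ z →
      rieszMean μ 2 z ≤ (4 / n) * ∑' k : ℕ, (max (z - μ k) 0) * μ k)
    (hN : Filter.Tendsto
      (fun lam : ℝ => (Set.ncard {k : ℕ | μ k ≤ lam} : ℝ) / lam ^ (n / 2))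
      Filter.atTop (nhds W)) :
    ∀ t : ℝ, 0 < t →
      (∑' k : ℕ, Real.exp (-(μ k * t))) ≤
        Real.Gamma (1 + n / 2) * W * t ^ (-(n / 2)) := by
  have hm : 0 < n / 2 := half_pos hn
  have hbound (V : ℝ) (hV : W < V) : ∃ C : ℝ, ∀ t : ℝ, 0 < t → ∀ K : ℕ,
      ∑ k ∈ Finset.range K, Real.exp (-(μ k * t)) ≤
        C + V * (Real.Gamma (1 + n / 2) * t ^ (-(n / 2))) := by
    obtain ⟨C, hC⟩ := exists_counting_le htend hW hV hN
    exact ⟨C, fun t ht K => sum_exp_le_of_counting_le hpos htend hm hC ht K⟩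
  have hsum (t : ℝ) (ht : 0 < t) : Summable fun k => Real.exp (-(μ k * t)) := by
    obtain ⟨C, hC⟩ := hbound (W + 1) (by linarith)
    exact summable_of_sum_range_le (fun _ => (Real.exp_pos _).le) (hC t ht)
  have hanti := antitoneOn_rpow_mul (m := n / 2)
    (fun t ht => hasDerivAt_tsum_exp hpos hsum ht) (fun t ht => by
      have h := mul_le_mul_of_nonneg_left
        (tsum_exp_le_mul_tsum_mul_exp hpos hsum hR2 ht) (div_pos hn four_pos).le
      calc _ = n / 4 * (2 * ∑' k, Real.exp (-(μ k * t))) := by ring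
        _ ≤ _ := h
        _ = _ := by
          generalize ∑' k, μ k * Real.exp (-(μ k * t)) = x
          field_simp)
  intro t ht
  have hV (V : ℝ) (hV : W < V) :
      t ^ (n / 2) * ∑' k, Real.exp (-(μ k * t)) ≤ V * Real.Gamma (1 + n / 2) := by
    obtain ⟨C, hC⟩ := hbound V hV
    have hlim : Tendsto (fun s : ℝ => C * s ^ (n / 2) + V * Real.Gamma (1 + n / 2))
        (𝓝[>] 0) (𝓝 (V * Real.Gamma (1 + n / 2))) := by
      have h := (Real.continuousAt_rpow_const 0 (n / 2) (Or.inr hm.le)).tendsto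
      rw [Real.zero_rpow hm.ne'] at h
      simpa using ((h.const_mul C).add_const (V * Real.Gamma (1 + n / 2))).mono_left
        nhdsWithin_le_nhds
    refine ge_of_tendsto hlim ?_
    filter_upwards [Ioo_mem_nhdsGT ht] with s hs
    have hp := Real.rpow_pos_of_pos hs.1 (n / 2)
    calc _ ≤ s ^ (n / 2) * ∑' k, Real.exp (-(μ k * s)) := hanti hs.1 ht hs.2.le
      _ ≤ s ^ (n / 2) * (C + V * (Real.Gamma (1 + n / 2) * s ^ (-(n / 2)))) := by
          gcongr
          exact Real.tsum_le_of_sum_range_le (fun _ => (Real.exp_pos _).le) (hC s hs.1)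
      _ = _ := by
          rw [Real.rpow_neg hs.1.le]
          field_simp
  have hp := Real.rpow_pos_of_pos ht (n / 2)
  have hfinal : t ^ (n / 2) * ∑' k, Real.exp (-(μ k * t)) ≤ W * Real.Gamma (1 + n / 2) := by
    have hlim : Tendsto (fun V : ℝ => V * Real.Gamma (1 + n / 2)) (𝓝[>] W)
        (𝓝 (W * Real.Gamma (1 + n / 2))) :=
      (tendsto_id.mul_const _).mono_left nhdsWithin_le_nhds
    exact ge_of_tendsto hlim (eventually_nhdsWithin_of_forall hV)
  rw [Real.rpow_neg ht.le, ← div_eq_mul_inv, le_div_iff₀ hp]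
  linarith
end
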